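/- arXiv:2510.11724 — 6 statements merged into one kernel-verified Lean document; each statement's English description precedes it below -/
import Mathlib

section
/- Let n, m, l, k, t be positive integers with 3 ≤ t ≤ l ≤ k and min{m, n} ≥ (t+1)(k−t+1). If 𝒜 ⊆ C([n],k) and ℬ ⊆ C([m],l) are cross-t-intersecting families, then |𝒜|·|ℬ| ≤ C(n−t, k−t)·C(m−t, l−t). -/
namespace CrossIntersecting

open Finset

/-- The number of `k`-sets in an `(s + a)`-set with a prescribed trace of size `g` on a fixed
`s`-subset. -/
def levelWeight (a k g : ℕ) : ℕ := if g ≤ k then a.choose (k - g) else 0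

/-- The number of `k`-sets in an `(s + a)`-set whose trace on a fixed `s`-subset lies in `𝒢`. -/
def weight (a k : ℕ) (𝒢 : Finset (Finset ℕ)) : ℕ := ∑ G ∈ 𝒢, levelWeight a k #G

/-- Any two members of `𝒢` and `ℋ` share at least `t` elements. -/
def Cross (t : ℕ) (𝒢 ℋ : Finset (Finset ℕ)) : Prop := ∀ G ∈ 𝒢, ∀ H ∈ ℋ, t ≤ #(G ∩ H)

/-- `𝒢` is closed under adding elements of `Icc 1 s`. -/
def IsUp (s : ℕ) (𝒢 : Finset (Finset ℕ)) : Prop := ∀ G ∈ 𝒢, ∀ x ∈ Icc 1 s, insert x G ∈ 𝒢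

/-- `𝒢` is closed under replacing an element by a smaller positive one. -/
def IsShifted (𝒢 : Finset (Finset ℕ)) : Prop :=
  ∀ G ∈ 𝒢, ∀ x y, 1 ≤ x → x < y → y ∈ G → x ∉ G → insert x (G.erase y) ∈ 𝒢

/-- A shifted pair of up-sets in `Icc 1 s` maximizing the product of weights among
cross-`t`-intersecting pairs. -/
structure IsOptimal (t s a k b l : ℕ) (𝒢 ℋ : Finset (Finset ℕ)) : Prop where
  sub_left : 𝒢 ⊆ (Icc 1 s).powerset
  sub_right : ℋ ⊆ (Icc 1 s).powerset
  cross : Cross t 𝒢 ℋ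
  up_left : IsUp s 𝒢
  up_right : IsUp s ℋ
  shifted_left : IsShifted 𝒢
  shifted_right : IsShifted ℋ
  max : ∀ 𝒢' ⊆ (Icc 1 s).powerset, ∀ ℋ' ⊆ (Icc 1 s).powerset, Cross t 𝒢' ℋ' →
    weight a k 𝒢' * weight b l ℋ' ≤ weight a k 𝒢 * weight b l ℋ

lemma Cross.symm {t : ℕ} {𝒢 ℋ : Finset (Finset ℕ)} (h : Cross t 𝒢 ℋ) : Cross t ℋ 𝒢 :=
  fun H hH G hG => by rw [inter_comm]; exact h G hG H hH

lemma IsOptimal.symm {t s a k b l : ℕ} {𝒢 ℋ : Finset (Finset ℕ)}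
    (h : IsOptimal t s a k b l 𝒢 ℋ) : IsOptimal t s b l a k ℋ 𝒢 where
  sub_left := h.sub_right
  sub_right := h.sub_left
  cross := h.cross.symm
  up_left := h.up_right
  up_right := h.up_left
  shifted_left := h.shifted_right
  shifted_right := h.shifted_left
  max := fun 𝒢' h𝒢 ℋ' hℋ hc => by
    rw [mul_comm, mul_comm (weight b l ℋ)]
    exact h.max ℋ' hℋ 𝒢' h𝒢 hc.symm

lemma weight_mono {a k : ℕ} {𝒢 ℋ : Finset (Finset ℕ)} (h : 𝒢 ⊆ ℋ) :
    weight a k 𝒢 ≤ weight a k ℋ := sum_le_sum_of_subset h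

/-! ### Shifting -/

/-- Replace `y` by `x` in `G`, unless the result is already in `𝒢`. -/
def shiftSet (x y : ℕ) (𝒢 : Finset (Finset ℕ)) (G : Finset ℕ) : Finset ℕ :=
  if y ∈ G ∧ x ∉ G ∧ insert x (G.erase y) ∉ 𝒢 then insert x (G.erase y) else G

/-- The `(x, y)`-shift of a family. -/
def shift (x y : ℕ) (𝒢 : Finset (Finset ℕ)) : Finset (Finset ℕ) := 𝒢.image (shiftSet x y 𝒢)

lemma insert_erase_inj {x y : ℕ} {G G' : Finset ℕ} (hy : y ∈ G) (hx : x ∉ G) (hy' : y ∈ G')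
    (hx' : x ∉ G') (h : insert x (G.erase y) = insert x (G'.erase y)) : G = G' := by
  ext z
  have := Finset.ext_iff.1 h z
  simp only [mem_insert, mem_erase] at this
  by_cases hzx : z = x
  · subst hzx; tauto
  · by_cases hzy : z = y
    · subst hzy; tauto
    · tauto

lemma shiftSet_injOn (x y : ℕ) (𝒢 : Finset (Finset ℕ)) : Set.InjOn (shiftSet x y 𝒢) 𝒢 := by
  intro G hG G' hG' h
  unfold shiftSet at h
  rw [mem_coe] at hG hG'
  split_ifs at h with h1 h2 h2
  · exact insert_erase_inj h1.1 h1.2.1 h2.1 h2.2.1 h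
  · exact absurd (h ▸ hG') h1.2.2
  · exact absurd (h ▸ hG) h2.2.2
  · exact h

lemma card_insert_erase {x y : ℕ} {G : Finset ℕ} (hy : y ∈ G) (hx : x ∉ G) :
    #(insert x (G.erase y)) = #G := by
  rw [card_insert_of_notMem (fun h => hx (mem_of_mem_erase h)), card_erase_of_mem hy]
  have := card_pos.2 ⟨y, hy⟩
  omega

lemma card_shiftSet (x y : ℕ) (𝒢 : Finset (Finset ℕ)) (G : Finset ℕ) :
    #(shiftSet x y 𝒢 G) = #G := by
  unfold shiftSet
  split_ifs with h
  · exact card_insert_erase h.1 h.2.1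
  · rfl

lemma weight_shift (x y a k : ℕ) (𝒢 : Finset (Finset ℕ)) :
    weight a k (shift x y 𝒢) = weight a k 𝒢 := by
  unfold weight shift
  rw [sum_image (shiftSet_injOn x y 𝒢)]
  simp [card_shiftSet]

lemma le_card_insert_erase_inter {t x y : ℕ} {𝒢 ℋ : Finset (Finset ℕ)} (hc : Cross t 𝒢 ℋ)
    {G H : Finset ℕ} (hG : G ∈ 𝒢) (hH : H ∈ ℋ) (hy : y ∈ G) (hx : x ∉ G)
    (h : y ∈ H → x ∉ H → insert x (H.erase y) ∈ ℋ) :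
    t ≤ #(insert x (G.erase y) ∩ H) := by
  have hxy : x ≠ y := fun h => hx (h ▸ hy)
  by_cases hyH : y ∈ H
  · by_cases hxH : x ∈ H
    · have : insert x (G.erase y) ∩ H = insert x ((G ∩ H).erase y) := by
        ext z; simp only [mem_inter, mem_insert, mem_erase]
        by_cases hz : z = x
        · subst hz; tauto
        · tauto
      rw [this, card_insert_erase (mem_inter.2 ⟨hy, hyH⟩) (fun h => hx (mem_inter.1 h).1)]
      exact hc G hG H hH
    · have : insert x (G.erase y) ∩ H = G ∩ insert x (H.erase y) := by
        ext z; simp only [mem_inter, mem_insert, mem_erase]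
        by_cases hz : z = x
        · subst hz; tauto
        · tauto
      rw [this]
      exact hc G hG _ (h hyH hxH)
  · refine (hc G hG H hH).trans (card_le_card fun z hz => ?_)
    rw [mem_inter] at hz ⊢
    refine ⟨mem_insert_of_mem (mem_erase.2 ⟨?_, hz.1⟩), hz.2⟩
    rintro rfl
    exact hyH hz.2

lemma Cross.shift {t : ℕ} {𝒢 ℋ : Finset (Finset ℕ)} (hc : Cross t 𝒢 ℋ) (x y : ℕ) :
    Cross t (shift x y 𝒢) (shift x y ℋ) := by
  intro G' hG' H' hH'
  obtain ⟨G, hG, rfl⟩ := mem_image.1 hG'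
  obtain ⟨H, hH, rfl⟩ := mem_image.1 hH'
  unfold shiftSet
  split_ifs with h1 h2 h2
  · have : insert x (G.erase y) ∩ insert x (H.erase y) = insert x ((G ∩ H).erase y) := by
      ext z; simp only [mem_inter, mem_insert, mem_erase]; tauto
    rw [this, card_insert_erase (mem_inter.2 ⟨h1.1, h2.1⟩) (fun h => h1.2.1 (mem_inter.1 h).1)]
    exact hc G hG H hH
  · exact le_card_insert_erase_inter hc hG hH h1.1 h1.2.1 (fun a b => by tauto)
  · rw [inter_comm]
    exact le_card_insert_erase_inter hc.symm hH hG h2.1 h2.2.1 (fun a b => by tauto)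
  · exact hc G hG H hH

/-- A potential which increases when sets are added or shifted down. -/
def potential (s : ℕ) (𝒢 : Finset (Finset ℕ)) : ℕ := ∑ G ∈ 𝒢, (1 + ∑ x ∈ G, (s - x))

lemma sum_insert_erase {s x y : ℕ} {G : Finset ℕ} (hxy : x < y) (hys : y ≤ s) (hy : y ∈ G)
    (hx : x ∉ G) : ∑ z ∈ G, (s - z) < ∑ z ∈ insert x (G.erase y), (s - z) := by
  rw [sum_insert (fun h => hx (mem_of_mem_erase h)), ← add_sum_erase G _ hy]
  omega

lemma le_sum_shiftSet {s x y : ℕ} {𝒢 : Finset (Finset ℕ)} {G : Finset ℕ}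
    (hG : G ⊆ Icc 1 s) (hxy : x < y) :
    ∑ z ∈ G, (s - z) ≤ ∑ z ∈ shiftSet x y 𝒢 G, (s - z) := by
  unfold shiftSet
  split_ifs with h
  · exact (sum_insert_erase hxy (mem_Icc.1 (hG h.1)).2 h.1 h.2.1).le
  · rfl

lemma potential_le_shift {s x y : ℕ} {𝒢 : Finset (Finset ℕ)} (h : 𝒢 ⊆ (Icc 1 s).powerset)
    (hxy : x < y) : potential s 𝒢 ≤ potential s (shift x y 𝒢) := by
  unfold potential shift
  rw [sum_image (shiftSet_injOn x y 𝒢)]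
  exact sum_le_sum fun G hG => Nat.add_le_add_left (le_sum_shiftSet (mem_powerset.1 (h hG)) hxy) 1

lemma potential_lt_shift {s x y : ℕ} {𝒢 : Finset (Finset ℕ)} (h : 𝒢 ⊆ (Icc 1 s).powerset)
    (hxy : x < y) {G : Finset ℕ} (hG : G ∈ 𝒢) (hy : y ∈ G) (hx : x ∉ G)
    (hn : insert x (G.erase y) ∉ 𝒢) : potential s 𝒢 < potential s (shift x y 𝒢) := by
  unfold potential shift
  rw [sum_image (shiftSet_injOn x y 𝒢)]
  refine sum_lt_sum
    (fun G hG => Nat.add_le_add_left (le_sum_shiftSet (mem_powerset.1 (h hG)) hxy) 1) ⟨G, hG, ?_⟩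
  have := sum_insert_erase hxy (mem_Icc.1 (mem_powerset.1 (h hG) hy)).2 hy hx
  rw [shiftSet, if_pos ⟨hy, hx, hn⟩]
  omega

lemma shift_subset {s x y : ℕ} {𝒢 : Finset (Finset ℕ)} (h : 𝒢 ⊆ (Icc 1 s).powerset)
    (hx : 1 ≤ x) (hxy : x < y) : shift x y 𝒢 ⊆ (Icc 1 s).powerset := by
  intro G' hG'
  obtain ⟨G, hG, rfl⟩ := mem_image.1 hG'
  have hGs := mem_powerset.1 (h hG)
  unfold shiftSet
  split_ifs with h1
  · have := (mem_Icc.1 (hGs h1.1)).2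
    exact mem_powerset.2 (insert_subset (mem_Icc.2 ⟨hx, by omega⟩) ((erase_subset _ _).trans hGs))
  · exact h hG

lemma Cross.insert {t : ℕ} {𝒢 ℋ : Finset (Finset ℕ)} (hc : Cross t 𝒢 ℋ) {G : Finset ℕ}
    (hG : G ∈ 𝒢) (x : ℕ) : Cross t (insert (insert x G) 𝒢) ℋ := by
  intro G' hG' H hH
  obtain rfl | hG' := mem_insert.1 hG'
  · exact (hc G hG H hH).trans (card_le_card (inter_subset_inter_right (subset_insert _ _)))
  · exact hc G' hG' H hH

lemma potential_lt_insert {s : ℕ} {𝒢 : Finset (Finset ℕ)} {G : Finset ℕ} (hG : G ∉ 𝒢) :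
    potential s 𝒢 < potential s (insert G 𝒢) := by
  unfold potential
  rw [sum_insert hG]
  omega

lemma exists_isOptimal (t s a k b l : ℕ) : ∃ 𝒢 ℋ, IsOptimal t s a k b l 𝒢 ℋ := by
  classical
  let C : Finset (Finset (Finset ℕ) × Finset (Finset ℕ)) :=
    {p ∈ (Icc 1 s).powerset.powerset ×ˢ (Icc 1 s).powerset.powerset | Cross t p.1 p.2}
  have memC : ∀ 𝒢 ℋ, (𝒢, ℋ) ∈ C ↔
      (𝒢 ⊆ (Icc 1 s).powerset ∧ ℋ ⊆ (Icc 1 s).powerset) ∧ Cross t 𝒢 ℋ := by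
    intro 𝒢 ℋ
    simp only [C, mem_filter, mem_product, mem_powerset]
  let f : Finset (Finset ℕ) × Finset (Finset ℕ) → ℕ := fun p => weight a k p.1 * weight b l p.2
  obtain ⟨p₀, hp₀, hmax₀⟩ := C.exists_max_image f
    ⟨(∅, ∅), (memC _ _).2 ⟨by simp, fun G hG => by simp at hG⟩⟩
  obtain ⟨⟨𝒢, ℋ⟩, hp, hmax⟩ := ({p ∈ C | f p₀ ≤ f p}).exists_max_image
    (fun p => potential s p.1 + potential s p.2) ⟨p₀, by simp [hp₀]⟩
  rw [mem_filter, memC] at hp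
  obtain ⟨⟨⟨h𝒢, hℋ⟩, hc⟩, hf⟩ := hp
  have key : ∀ 𝒢' ⊆ (Icc 1 s).powerset, ∀ ℋ' ⊆ (Icc 1 s).powerset, Cross t 𝒢' ℋ' →
      weight a k 𝒢 ≤ weight a k 𝒢' → weight b l ℋ ≤ weight b l ℋ' →
      potential s 𝒢' + potential s ℋ' ≤ potential s 𝒢 + potential s ℋ := by
    intro 𝒢' h𝒢' ℋ' hℋ' hc' hw hw'
    exact hmax (𝒢', ℋ') (mem_filter.2 ⟨(memC _ _).2 ⟨⟨h𝒢', hℋ'⟩, hc'⟩,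
      hf.trans (Nat.mul_le_mul hw hw')⟩)
  refine ⟨𝒢, ℋ, h𝒢, hℋ, hc, ?_, ?_, ?_, ?_, ?_⟩
  · intro G hG x hx
    by_contra hn
    have := potential_lt_insert (s := s) hn
    have := key _ (insert_subset (mem_powerset.2 (insert_subset hx (mem_powerset.1 (h𝒢 hG)))) h𝒢)
      ℋ hℋ (hc.insert hG x) (weight_mono (subset_insert _ _)) le_rfl
    omega
  · intro H hH x hx
    by_contra hn
    have := potential_lt_insert (s := s) hn
    have := key 𝒢 h𝒢 _
      (insert_subset (mem_powerset.2 (insert_subset hx (mem_powerset.1 (hℋ hH)))) hℋ)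
      (hc.symm.insert hH x).symm le_rfl (weight_mono (subset_insert _ _))
    omega
  · intro G hG x y hx hxy hy hxG
    by_contra hn
    have h1 := potential_lt_shift h𝒢 hxy hG hy hxG hn
    have h2 := potential_le_shift hℋ hxy
    have := key _ (shift_subset h𝒢 hx hxy) _ (shift_subset hℋ hx hxy) (hc.shift x y)
      (weight_shift ..).ge (weight_shift ..).ge
    omega
  · intro G hG x y hx hxy hy hxG
    by_contra hn
    have h1 := potential_lt_shift hℋ hxy hG hy hxG hn
    have h2 := potential_le_shift h𝒢 hxy
    have := key _ (shift_subset h𝒢 hx hxy) _ (shift_subset hℋ hx hxy) (hc.shift x y)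
      (weight_shift ..).ge (weight_shift ..).ge
    omega
  · intro 𝒢' h𝒢' ℋ' hℋ' hc'
    exact (hmax₀ (𝒢', ℋ') ((memC _ _).2 ⟨⟨h𝒢', hℋ'⟩, hc'⟩)).trans hf

/-! ### Eliminating the last element -/

/-- The `g`-sets `G ⊆ Icc 1 s` outside `𝒢` for which `insert (s + 1) G ∈ 𝒢`. -/
def pivotal (s g : ℕ) (𝒢 : Finset (Finset ℕ)) : Finset (Finset ℕ) :=
  {G ∈ (Icc 1 s).powersetCard g | insert (s + 1) G ∈ 𝒢 ∧ G ∉ 𝒢}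

lemma mem_pivotal {s g : ℕ} {𝒢 : Finset (Finset ℕ)} {G : Finset ℕ} :
    G ∈ pivotal s g 𝒢 ↔ (G ⊆ Icc 1 s ∧ #G = g) ∧ insert (s + 1) G ∈ 𝒢 ∧ G ∉ 𝒢 := by
  rw [pivotal, mem_filter, mem_powersetCard]

lemma last_notMem {s : ℕ} {G : Finset ℕ} (h : G ⊆ Icc 1 s) : s + 1 ∉ G := fun hm => by
  have := (mem_Icc.1 (h hm)).2
  omega

lemma Icc_one_succ (s : ℕ) : Icc 1 (s + 1) = insert (s + 1) (Icc 1 s) := by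
  ext x; simp only [mem_Icc, mem_insert]; omega

lemma shift_last {s y : ℕ} {𝒢 : Finset (Finset ℕ)} (h : IsShifted 𝒢) {G : Finset ℕ}
    (hG : G ⊆ Icc 1 s) (hG' : insert (s + 1) G ∈ 𝒢) (hy : y ∈ Icc 1 s) (hyG : y ∉ G) :
    insert y G ∈ 𝒢 := by
  have hy' := mem_Icc.1 hy
  have := h _ hG' y (s + 1) hy'.1 (by omega) (mem_insert_self _ _)
    (by rw [mem_insert]; rintro (h | h); · omega
        · exact hyG h)
  rwa [erase_insert (last_notMem hG)] at this

lemma card_insert_last_inter {s : ℕ} {G H : Finset ℕ} (hG : G ⊆ Icc 1 s) :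
    #(insert (s + 1) G ∩ insert (s + 1) H) = #(G ∩ H) + 1 := by
  rw [← insert_inter_distrib,
    card_insert_of_notMem fun h => last_notMem hG (mem_inter.1 h).1]

/-- If removing the last element from two members spoils the intersection condition, the sizes of
the members are linked. -/
lemma le_card_inter_or {s t : ℕ} {𝒢 ℋ : Finset (Finset ℕ)} (hc : Cross t 𝒢 ℋ)
    (hs : IsShifted 𝒢) {G H : Finset ℕ} (hG : G ⊆ Icc 1 s) (hH : H ⊆ Icc 1 s)
    (hG' : insert (s + 1) G ∈ 𝒢) (hH' : insert (s + 1) H ∈ ℋ) :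
    t ≤ #(G ∩ H) ∨ #G + #H + 1 = s + t := by
  have h1 := hc _ hG' _ hH'
  rw [card_insert_last_inter hG] at h1
  by_cases h2 : t ≤ #(G ∩ H)
  · exact Or.inl h2
  right
  have hcov : G ∪ H = Icc 1 s := by
    refine subset_antisymm (union_subset hG hH) fun y hy => ?_
    by_contra hn
    rw [mem_union, not_or] at hn
    have h3 := hc _ (shift_last hs hG hG' hy hn.1) _ hH'
    apply h2
    refine h3.trans (card_le_card fun z hz => ?_)
    rw [mem_inter, mem_insert, mem_insert] at hz
    have := mem_Icc.1 hy
    rcases hz with ⟨rfl | h4, rfl | h5⟩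
    · omega
    · exact absurd h5 hn.2
    · exact absurd h4 (last_notMem hG)
    · exact mem_inter.2 ⟨h4, h5⟩
  have := card_union_add_card_inter G H
  rw [hcov, Nat.card_Icc] at this
  omega

lemma cross_push {s t g h : ℕ} {𝒢 ℋ : Finset (Finset ℕ)} (hc : Cross t 𝒢 ℋ)
    (hs : IsShifted 𝒢) (hℋ : ℋ ⊆ (Icc 1 (s + 1)).powerset) (hgh : g + h + 1 = s + t) :
    Cross t (𝒢 ∪ pivotal s g 𝒢) (ℋ \ (pivotal s h ℋ).image (insert (s + 1))) := by
  intro G hG H hH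
  rw [mem_sdiff] at hH
  rcases mem_union.1 hG with hG | hG
  · exact hc G hG H hH.1
  rw [mem_pivotal] at hG
  obtain ⟨⟨hGs, rfl⟩, hG1, -⟩ := hG
  have hHs := mem_powerset.1 (hℋ hH.1)
  by_cases hz : s + 1 ∈ H
  · have hH0 : insert (s + 1) (H.erase (s + 1)) = H := insert_erase hz
    have hHs' : H.erase (s + 1) ⊆ Icc 1 s := by
      rw [Icc_one_succ] at hHs
      exact subset_insert_iff.1 hHs
    have hGH : #(G ∩ H.erase (s + 1)) ≤ #(G ∩ H) :=
      card_le_card (inter_subset_inter_left (erase_subset _ _))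
    rcases le_card_inter_or hc hs hGs hHs' hG1 (hH0.symm ▸ hH.1) with h1 | h1
    · exact h1.trans hGH
    · have h2 : H.erase (s + 1) ∈ ℋ := by
        by_contra hn
        refine hH.2 (mem_image.2 ⟨_, mem_pivotal.2 ⟨⟨hHs', by omega⟩, hH0.symm ▸ hH.1, hn⟩, hH0⟩)
      have := hc _ hG1 _ h2
      rw [insert_inter_of_notMem (notMem_erase _ _)] at this
      exact this.trans hGH
  · have := hc _ hG1 _ hH.1
    rwa [insert_inter_of_notMem hz] at this

lemma weight_push (a k s g : ℕ) (𝒢 : Finset (Finset ℕ)) :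
    weight a k (𝒢 ∪ pivotal s g 𝒢) = weight a k 𝒢 + #(pivotal s g 𝒢) * levelWeight a k g := by
  unfold weight
  rw [sum_union (disjoint_right.2 fun G hG => (mem_pivotal.1 hG).2.2), add_right_inj,
    sum_congr rfl fun G hG => by rw [(mem_pivotal.1 hG).1.2], sum_const, smul_eq_mul]

lemma insert_last_injOn {s : ℕ} {𝒞 : Finset (Finset ℕ)} (h : ∀ G ∈ 𝒞, G ⊆ Icc 1 s) :
    Set.InjOn (insert (s + 1)) (𝒞 : Set (Finset ℕ)) := fun G hG H hH he => by
  rw [← erase_insert (last_notMem (h G hG)), he, erase_insert (last_notMem (h H hH))]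

lemma weight_image_insert_last {s g : ℕ} {𝒞 : Finset (Finset ℕ)} (a k : ℕ)
    (h : ∀ G ∈ 𝒞, G ⊆ Icc 1 s ∧ #G = g) :
    weight a k (𝒞.image (insert (s + 1))) = #𝒞 * levelWeight a k (g + 1) := by
  unfold weight
  rw [sum_image (insert_last_injOn fun G hG => (h G hG).1),
    sum_congr rfl fun G hG => by rw [card_insert_of_notMem (last_notMem (h G hG).1), (h G hG).2],
    sum_const, smul_eq_mul]

lemma weight_remove (a k s g : ℕ) (𝒢 : Finset (Finset ℕ)) :
    weight a k (𝒢 \ (pivotal s g 𝒢).image (insert (s + 1))) +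
      #(pivotal s g 𝒢) * levelWeight a k (g + 1) = weight a k 𝒢 := by
  rw [← weight_image_insert_last (s := s) a k fun G hG => (mem_pivotal.1 hG).1]
  refine sum_sdiff fun G hG => ?_
  obtain ⟨G', hG', rfl⟩ := mem_image.1 hG
  exact (mem_pivotal.1 hG').2.1

lemma pivotal_subset (s g : ℕ) (𝒢 : Finset (Finset ℕ)) :
    pivotal s g 𝒢 ⊆ (Icc 1 (s + 1)).powerset := fun G hG => by
  rw [Icc_one_succ]
  exact mem_powerset.2 ((mem_pivotal.1 hG).1.1.trans (subset_insert _ _))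

lemma IsOptimal.push_le {t s a k b l g h : ℕ} {𝒢 ℋ : Finset (Finset ℕ)}
    (ho : IsOptimal t (s + 1) a k b l 𝒢 ℋ) (hgh : g + h + 1 = s + t) :
    (weight a k 𝒢 + #(pivotal s g 𝒢) * levelWeight a k g) *
      (weight b l ℋ - #(pivotal s h ℋ) * levelWeight b l (h + 1) : ℤ) ≤
    weight a k 𝒢 * weight b l ℋ := by
  have h1 := ho.max _ (union_subset ho.sub_left (pivotal_subset s g 𝒢)) _
    (sdiff_subset.trans ho.sub_right) (cross_push ho.cross ho.shifted_left ho.sub_right hgh)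
  rw [weight_push] at h1
  have h2 := weight_remove b l s h ℋ
  zify at h1 h2
  rwa [← h2, add_sub_cancel_right, h2]

/-- The `(g + 1)`-sets of `𝒢` inside `Icc 1 s`. -/
def upperLevel (s g : ℕ) (𝒢 : Finset (Finset ℕ)) : Finset (Finset ℕ) :=
  {G ∈ (Icc 1 s).powersetCard (g + 1) | G ∈ 𝒢}

lemma mem_upperLevel {s g : ℕ} {𝒢 : Finset (Finset ℕ)} {G : Finset ℕ} :
    G ∈ upperLevel s g 𝒢 ↔ (G ⊆ Icc 1 s ∧ #G = g + 1) ∧ G ∈ 𝒢 := by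
  rw [upperLevel, mem_filter, mem_powersetCard]

lemma card_pivotal_mul_le {s g : ℕ} {𝒢 : Finset (Finset ℕ)} (hs : IsShifted 𝒢) :
    #(pivotal s g 𝒢) * (s - g) ≤ #(upperLevel s g 𝒢) * (g + 1) := by
  refine card_mul_le_card_mul (· ⊆ ·) (fun G hG => ?_) (fun G' hG' => ?_)
  · obtain ⟨⟨hGs, hGc⟩, hG1, -⟩ := mem_pivotal.1 hG
    have hcard : #(Icc 1 s \ G) = s - g := by
      rw [card_sdiff_of_subset hGs, Nat.card_Icc, hGc, Nat.add_sub_cancel]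
    rw [← hcard]
    refine card_le_card_of_injOn (fun y => insert y G) (fun y hy => ?_) (fun y hy y' hy' he => ?_)
    · obtain ⟨hy, hyG⟩ := mem_sdiff.1 hy
      exact mem_bipartiteAbove _ |>.2 ⟨mem_upperLevel.2 ⟨⟨insert_subset hy hGs,
        by rw [card_insert_of_notMem hyG, hGc]⟩, shift_last hs hGs hG1 hy hyG⟩, subset_insert _ _⟩
    · have h1 : y ∈ insert y' G := by
        have : y ∈ insert y G := mem_insert_self _ _
        rwa [show insert y G = insert y' G from he] at this
      exact (mem_insert.1 h1).resolve_right (mem_sdiff.1 hy).2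
  · obtain ⟨⟨-, hGc⟩, -⟩ := mem_upperLevel.1 hG'
    calc _ ≤ #(G'.powersetCard g) := card_le_card fun G hG => by
          obtain ⟨hG, hGG⟩ := (mem_bipartiteBelow _).1 hG
          exact mem_powersetCard.2 ⟨hGG, (mem_pivotal.1 hG).1.2⟩
      _ = g + 1 := by rw [card_powersetCard, hGc, Nat.choose_succ_self_right]

lemma le_weight {s g : ℕ} {𝒢 : Finset (Finset ℕ)} (a k : ℕ) (hu : IsUp (s + 1) 𝒢) :
    #(pivotal s g 𝒢) * levelWeight a k (g + 1) + #(upperLevel s g 𝒢) *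
      (levelWeight a k (g + 1) + levelWeight a k (g + 2)) ≤ weight a k 𝒢 := by
  have e1 := weight_image_insert_last (s := s) a k fun G hG =>
    (mem_pivotal (g := g) (𝒢 := 𝒢).1 hG).1
  have e2 := weight_image_insert_last (s := s) a k fun G hG =>
    (mem_upperLevel (g := g) (𝒢 := 𝒢).1 hG).1
  have e3 : weight a k (upperLevel s g 𝒢) = #(upperLevel s g 𝒢) * levelWeight a k (g + 1) := by
    unfold weight
    rw [sum_congr rfl fun G hG => by rw [(mem_upperLevel.1 hG).1.2], sum_const, smul_eq_mul]
  have d1 : Disjoint ((pivotal s g 𝒢).image (insert (s + 1)))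
      ((upperLevel s g 𝒢).image (insert (s + 1))) := by
    refine disjoint_left.2 fun G hG hG' => ?_
    obtain ⟨A, hA, rfl⟩ := mem_image.1 hG
    obtain ⟨B, hB, he⟩ := mem_image.1 hG'
    obtain ⟨⟨hA1, hA2⟩, -⟩ := mem_pivotal.1 hA
    obtain ⟨⟨hB1, hB2⟩, -⟩ := mem_upperLevel.1 hB
    have := congrArg card he
    rw [card_insert_of_notMem (last_notMem hA1), card_insert_of_notMem (last_notMem hB1)] at this
    omega
  have d2 : Disjoint ((pivotal s g 𝒢).image (insert (s + 1)) ∪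
      (upperLevel s g 𝒢).image (insert (s + 1))) (upperLevel s g 𝒢) := by
    refine disjoint_left.2 fun G hG hG' => last_notMem (mem_upperLevel.1 hG').1.1 ?_
    rcases mem_union.1 hG with h | h <;>
    · obtain ⟨A, -, rfl⟩ := mem_image.1 h
      exact mem_insert_self _ _
  have hsub : (pivotal s g 𝒢).image (insert (s + 1)) ∪
      (upperLevel s g 𝒢).image (insert (s + 1)) ∪ upperLevel s g 𝒢 ⊆ 𝒢 := by
    refine union_subset (union_subset (fun G hG => ?_) (fun G hG => ?_)) (fun G hG => ?_)
    · obtain ⟨A, hA, rfl⟩ := mem_image.1 hG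
      exact (mem_pivotal.1 hA).2.1
    · obtain ⟨A, hA, rfl⟩ := mem_image.1 hG
      exact hu _ (mem_upperLevel.1 hA).2 _ (mem_Icc.2 ⟨by omega, le_rfl⟩)
    · exact (mem_upperLevel.1 hG).2
  have := weight_mono (a := a) (k := k) hsub
  have e4 : weight a k ((pivotal s g 𝒢).image (insert (s + 1)) ∪
      (upperLevel s g 𝒢).image (insert (s + 1)) ∪ upperLevel s g 𝒢) =
      weight a k ((pivotal s g 𝒢).image (insert (s + 1))) +
      weight a k ((upperLevel s g 𝒢).image (insert (s + 1))) +
      weight a k (upperLevel s g 𝒢) := by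
    rw [weight, sum_union d2, sum_union d1]; rfl
  rw [e4, e1, e2, e3] at this
  linarith

/-- The family on `Icc 1 s` obtained by forgetting the last element of members of size at most
`k`. -/
def project (s k : ℕ) (𝒢 : Finset (Finset ℕ)) : Finset (Finset ℕ) :=
  {G ∈ (Icc 1 s).powerset | G ∈ 𝒢 ∨ insert (s + 1) G ∈ 𝒢 ∧ #G + 1 ≤ k}

lemma mem_project {s k : ℕ} {𝒢 : Finset (Finset ℕ)} {G : Finset ℕ} :
    G ∈ project s k 𝒢 ↔ G ⊆ Icc 1 s ∧ (G ∈ 𝒢 ∨ insert (s + 1) G ∈ 𝒢 ∧ #G + 1 ≤ k) := by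
  rw [project, mem_filter, mem_powerset]

lemma cross_project {s t k l : ℕ} {𝒢 ℋ : Finset (Finset ℕ)} (hc : Cross t 𝒢 ℋ)
    (hs : IsShifted 𝒢) (hu : IsUp (s + 1) 𝒢) (hu' : IsUp (s + 1) ℋ)
    (hp : ∀ g h, g + 1 ≤ k → h + 1 ≤ l → g + h + 1 = s + t →
      pivotal s g 𝒢 = ∅ ∨ pivotal s h ℋ = ∅) :
    Cross t (project s k 𝒢) (project s l ℋ) := by
  intro G hG H hH
  obtain ⟨hGs, hG⟩ := mem_project.1 hG
  obtain ⟨hHs, hH⟩ := mem_project.1 hH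
  have hlast : s + 1 ∈ Icc 1 (s + 1) := mem_Icc.2 ⟨by omega, le_rfl⟩
  have hG1 : insert (s + 1) G ∈ 𝒢 := hG.elim (fun h => hu _ h _ hlast) (·.1)
  have hH1 : insert (s + 1) H ∈ ℋ := hH.elim (fun h => hu' _ h _ hlast) (·.1)
  by_cases hG2 : G ∈ 𝒢
  · have := hc _ hG2 _ hH1
    rwa [inter_insert_of_notMem (last_notMem hGs)] at this
  by_cases hH2 : H ∈ ℋ
  · have := hc _ hG1 _ hH2
    rwa [insert_inter_of_notMem (last_notMem hHs)] at this
  rcases le_card_inter_or hc hs hGs hHs hG1 hH1 with h | h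
  · exact h
  · exfalso
    rcases hp _ _ (hG.resolve_left hG2).2 (hH.resolve_left hH2).2 h with h' | h'
    · exact notMem_empty G (h' ▸ mem_pivotal.2 ⟨⟨hGs, rfl⟩, hG1, hG2⟩)
    · exact notMem_empty H (h' ▸ mem_pivotal.2 ⟨⟨hHs, rfl⟩, hH1, hH2⟩)

lemma levelWeight_add (a k g : ℕ) :
    levelWeight a k g + levelWeight a k (g + 1) = levelWeight (a + 1) k g := by
  unfold levelWeight
  rcases lt_trichotomy g k with h | h | h
  · obtain ⟨r, rfl⟩ := Nat.exists_eq_add_of_lt h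
    rw [if_pos (by omega), if_pos (by omega), if_pos (by omega),
      show g + r + 1 - g = r + 1 by omega, show g + r + 1 - (g + 1) = r by omega,
      Nat.choose_succ_succ, add_comm]
  · subst h; simp
  · rw [if_neg (by omega), if_neg (by omega), if_neg (by omega)]

lemma weight_le_project {s a k : ℕ} {𝒢 : Finset (Finset ℕ)}
    (h𝒢 : 𝒢 ⊆ (Icc 1 (s + 1)).powerset) :
    weight a k 𝒢 ≤ weight (a + 1) k (project s k 𝒢) := by
  have hdis : Disjoint (Icc 1 s).powerset ((Icc 1 s).powerset.image (insert (s + 1))) := by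
    refine disjoint_left.2 fun G hG hG' => last_notMem (mem_powerset.1 hG) ?_
    obtain ⟨A, -, rfl⟩ := mem_image.1 hG'
    exact mem_insert_self _ _
  have e1 : weight a k 𝒢 =
      ∑ G ∈ (Icc 1 (s + 1)).powerset, if G ∈ 𝒢 then levelWeight a k #G else 0 := by
    rw [← sum_filter, filter_mem_eq_inter, inter_eq_right.2 h𝒢, weight]
  rw [e1, Icc_one_succ, powerset_insert, sum_union hdis,
    sum_image (insert_last_injOn fun G hG => mem_powerset.1 hG), ← sum_add_distrib,
    weight, project, sum_filter]
  refine sum_le_sum fun G hG => ?_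
  rw [card_insert_of_notMem (last_notMem (mem_powerset.1 hG)), ← levelWeight_add]
  by_cases h1 : G ∈ 𝒢
  · rw [if_pos h1, if_pos (Or.inl h1)]
    gcongr
    split_ifs <;> simp
  · rw [if_neg h1, zero_add]
    by_cases h2 : insert (s + 1) G ∈ 𝒢
    · rw [if_pos h2]
      by_cases h3 : #G + 1 ≤ k
      · rw [if_pos (Or.inr ⟨h2, h3⟩)]; omega
      · simp [levelWeight, h3]
    · rw [if_neg h2]; exact Nat.zero_le _

/-! ### Critical pairs of levels -/

lemma mul_levelWeight (e r g : ℕ) : (r + 1) * levelWeight (e + r) (g + 1 + r) g =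
    e * levelWeight (e + r) (g + 1 + r) (g + 1) := by
  have := Nat.choose_succ_right_eq (e + r) r
  rw [Nat.add_sub_cancel] at this
  rw [levelWeight, levelWeight, if_pos (by omega), if_pos (by omega),
    show g + 1 + r - g = r + 1 by omega, show g + 1 + r - (g + 1) = r by omega]
  linarith

lemma mul_levelWeight_add_two (e r g : ℕ) : (e + 1) * levelWeight (e + r) (g + 1 + r) (g + 2) =
    r * levelWeight (e + r) (g + 1 + r) (g + 1) := by
  cases r with
  | zero => simp [levelWeight]
  | succ r =>
    have := Nat.choose_succ_right_eq (e + (r + 1)) r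
    rw [show e + (r + 1) - r = e + 1 by omega] at this
    rw [levelWeight, levelWeight, if_pos (by omega), if_pos (by omega),
      show g + 1 + (r + 1) - (g + 2) = r by omega, show g + 1 + (r + 1) - (g + 1) = r + 1 by omega]
    linarith

lemma levelWeight_pos (e r g : ℕ) : 0 < levelWeight (e + r) (g + 1 + r) (g + 1) := by
  rw [levelWeight, if_pos (by omega)]
  exact Nat.choose_pos (by omega)

/-- The weight of the members of `𝒢` that are lost when the last element is removed from the
`(g + 1)`-sets. -/
def lostWeight (s g a k : ℕ) (𝒢 : Finset (Finset ℕ)) : ℕ :=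
  #(pivotal s g 𝒢) * levelWeight a k (g + 1)

lemma IsOptimal.exchange {t s e r f q g h : ℕ} {𝒢 ℋ : Finset (Finset ℕ)}
    (ho : IsOptimal t (s + 1) (e + r) (g + 1 + r) (f + q) (h + 1 + q) 𝒢 ℋ)
    (hgh : g + h + 1 = s + t) :
    (e * (lostWeight s g (e + r) (g + 1 + r) 𝒢 *
      (weight (f + q) (h + 1 + q) ℋ - lostWeight s h (f + q) (h + 1 + q) ℋ)) : ℤ) ≤
    (r + 1) * (weight (e + r) (g + 1 + r) 𝒢 * lostWeight s h (f + q) (h + 1 + q) ℋ) := by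
  have h1 := ho.push_le hgh
  have h2 := mul_levelWeight e r g
  unfold lostWeight
  zify at h2
  push_cast
  have h3 : (0 : ℤ) ≤ r + 1 := by positivity
  have h4 := mul_le_mul_of_nonneg_left h1 h3
  linear_combination h4 - #(pivotal s g 𝒢) * (weight (f + q) (h + 1 + q) ℋ -
    #(pivotal s h ℋ) * levelWeight (f + q) (h + 1 + q) (h + 1) : ℤ) * h2

lemma IsOptimal.surplus_le {t s e r f q g h : ℕ} {𝒢 ℋ : Finset (Finset ℕ)}
    (ho : IsOptimal t (s + 1) (e + r) (g + 1 + r) (f + q) (h + 1 + q) 𝒢 ℋ)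
    (hgh : g + h + 1 = s + t) (hH : (pivotal s h ℋ).Nonempty) :
    ((e * f - (r + 1) * (q + 1)) *
      (weight (e + r) (g + 1 + r) 𝒢 - lostWeight s g (e + r) (g + 1 + r) 𝒢) : ℤ) ≤
    (q + 1) * (e + r + 1) * lostWeight s g (e + r) (g + 1 + r) 𝒢 := by
  have h1 := ho.exchange hgh
  have h2 := ho.symm.exchange (by omega : h + g + 1 = s + t)
  have hB : (0 : ℤ) < lostWeight s h (f + q) (h + 1 + q) ℋ := by
    have := Nat.mul_pos (card_pos.2 hH) (levelWeight_pos f q h)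
    exact_mod_cast this
  set A : ℤ := ↑(lostWeight s g (e + r) (g + 1 + r) 𝒢)
  set B : ℤ := ↑(lostWeight s h (f + q) (h + 1 + q) ℋ)
  set X : ℤ := ↑(weight (e + r) (g + 1 + r) 𝒢)
  set Y : ℤ := ↑(weight (f + q) (h + 1 + q) ℋ)
  have h3 := mul_le_mul_of_nonneg_left h2 (Int.natCast_nonneg e)
  have h4 := mul_le_mul_of_nonneg_left h1 (by positivity : (0 : ℤ) ≤ q + 1)
  refine le_of_mul_le_mul_right ?_ hB
  linear_combination h3 + h4

lemma spread_le {s e r g : ℕ} {𝒢 : Finset (Finset ℕ)} (hu : IsUp (s + 1) 𝒢) (hs : IsShifted 𝒢)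
    (hg : g ≤ s) :
    ((s - g) * (e + r + 1) * lostWeight s g (e + r) (g + 1 + r) 𝒢 : ℤ) ≤
    (g + 1) * (e + 1) *
      (weight (e + r) (g + 1 + r) 𝒢 - lostWeight s g (e + r) (g + 1 + r) 𝒢) := by
  have h1 := le_weight (g := g) (e + r) (g + 1 + r) hu
  have h2 := card_pivotal_mul_le (s := s) (g := g) hs
  have h3 := mul_levelWeight_add_two e r g
  unfold lostWeight
  zify [hg] at h1 h2 h3
  push_cast
  have h4 := mul_le_mul_of_nonneg_left h1 (by positivity : (0 : ℤ) ≤ (g + 1) * (e + 1))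
  have h5 := mul_le_mul_of_nonneg_right h2 (by positivity :
    (0 : ℤ) ≤ (e + r + 1) * levelWeight (e + r) (g + 1 + r) (g + 1))
  linear_combination h4 + h5 - (g + 1) * #(upperLevel s g 𝒢) * h3

lemma IsOptimal.numeric {t s e r f q g h : ℕ} {𝒢 ℋ : Finset (Finset ℕ)}
    (ho : IsOptimal t (s + 1) (e + r) (g + 1 + r) (f + q) (h + 1 + q) 𝒢 ℋ)
    (hgh : g + h + 1 = s + t) (hG : (pivotal s g 𝒢).Nonempty) (hH : (pivotal s h ℋ).Nonempty)
    (hg : g ≤ s) (hD : (r + 1) * (q + 1) ≤ e * f) :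
    ((s - g) * (e * f - (r + 1) * (q + 1)) : ℤ) ≤ (g + 1) * (e + 1) * (q + 1) := by
  have h1 := ho.surplus_le hgh hH
  have h2 := spread_le (e := e) (r := r) ho.up_left ho.shifted_left hg
  have hA : (0 : ℤ) < lostWeight s g (e + r) (g + 1 + r) 𝒢 := by
    have := Nat.mul_pos (card_pos.2 hG) (levelWeight_pos e r g)
    exact_mod_cast this
  have h3 := mul_le_mul_of_nonneg_left h1 (by positivity : (0 : ℤ) ≤ (g + 1) * (e + 1))
  have hD' : (0 : ℤ) ≤ e * f - (r + 1) * (q + 1) := by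
    rw [sub_nonneg]; exact_mod_cast hD
  have h4 := mul_le_mul_of_nonneg_left h2 hD'
  refine le_of_mul_le_mul_right ?_ (mul_pos (by positivity : (0 : ℤ) < e + r + 1) hA)
  linear_combination h3 + h4

lemma numeric_lt {τ u v p q e f : ℤ} (hτ : 2 ≤ τ) (hu : 0 ≤ u) (huv : u ≤ v) (hv : 1 ≤ v)
    (hp : 1 ≤ p) (hq : 1 ≤ q) (hf : (τ + 1) * q + (τ + 1) * v - u ≤ f) (hep : τ * p ≤ e)
    (heq : (τ + 1) * q ≤ e) : (τ + 2 + u) * (e + 1) * q < (v + 1) * (e * f - p * q) := by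
  have he : 0 ≤ e := le_trans (by positivity) heq
  have hvτ : 2 ≤ v * τ := by nlinarith
  have h1 : q * (v * τ - 1) + (v + 1) * v * τ ≤ (v + 1) * f - (τ + 2 + u) * q := by
    have h2 := mul_le_mul_of_nonneg_left hf (by omega : 0 ≤ v + 1)
    have h3 : 0 ≤ (v - u) * q := mul_nonneg (by omega) (by omega)
    have h4 : 0 ≤ (v + 1) * (v - u) := mul_nonneg (by omega) (by omega)
    linarith
  have h5 := mul_le_mul_of_nonneg_left h1 he
  have h6 : p * q * (v + 1) ≤ e * (q * (v * τ - 1)) := by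
    have h7 : v + 1 ≤ τ * (v * τ - 1) := by nlinarith
    calc p * q * (v + 1) ≤ p * q * (τ * (v * τ - 1)) := by gcongr
      _ = τ * p * (q * (v * τ - 1)) := by ring
      _ ≤ e * (q * (v * τ - 1)) :=
        mul_le_mul_of_nonneg_right hep (mul_nonneg (by omega) (by omega))
  have h8 : q * (τ + 2 + u) < e * ((v + 1) * v * τ) := by
    have h9 : τ + 2 + u < (τ + 1) * ((v + 1) * 2) := by nlinarith
    calc q * (τ + 2 + u) < q * ((τ + 1) * ((v + 1) * 2)) := by gcongr
      _ ≤ q * ((τ + 1) * ((v + 1) * (v * τ))) := by gcongr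
      _ = (τ + 1) * q * ((v + 1) * v * τ) := by ring
      _ ≤ e * ((v + 1) * v * τ) := mul_le_mul_of_nonneg_right heq (by positivity)
  linarith

lemma le_succ_of_pivotal {t s g h : ℕ} {𝒢 ℋ : Finset (Finset ℕ)} (hc : Cross t 𝒢 ℋ)
    (hG : (pivotal s g 𝒢).Nonempty) (hH : (pivotal s h ℋ).Nonempty) : t ≤ g + 1 := by
  obtain ⟨G, hG⟩ := hG
  obtain ⟨H, hH⟩ := hH
  obtain ⟨⟨hG1, rfl⟩, hG2, -⟩ := mem_pivotal.1 hG
  have := hc _ hG2 _ (mem_pivotal.1 hH).2.1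
  rw [card_insert_last_inter hG1] at this
  exact this.trans (Nat.succ_le_succ (card_le_card inter_subset_left))

lemma IsOptimal.false_of_full {t s e r f q h : ℕ} {𝒢 ℋ : Finset (Finset ℕ)}
    (ho : IsOptimal t (s + 1) (e + r) (s + 1 + r) (f + q) (h + 1 + q) 𝒢 ℋ) (hht : h + 1 = t)
    (hG : (pivotal s s 𝒢).Nonempty) (hH : (pivotal s h ℋ).Nonempty) (hhs : h ≤ s)
    (hn : (t * (r + 1) : ℤ) < e * (s - h)) : False := by
  have hX : weight (e + r) (s + 1 + r) 𝒢 ≤ lostWeight s s (e + r) (s + 1 + r) 𝒢 := by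
    obtain ⟨H, hH⟩ := hH
    obtain ⟨⟨hH1, hH2⟩, hH3, -⟩ := mem_pivotal.1 hH
    have hsub : 𝒢 ⊆ {Icc 1 (s + 1)} := by
      refine fun G hG => mem_singleton.2 (subset_antisymm (mem_powerset.1 (ho.sub_left hG)) ?_)
      have key : ∀ y, y ∉ H → insert y H ∈ ℋ → insert y H ⊆ G := fun y hy hyH => by
        have h1 := ho.cross _ hG _ hyH
        have h2 : #(insert y H) = t := by rw [card_insert_of_notMem hy, hH2, hht]
        rw [← inter_eq_right]
        exact eq_of_subset_of_card_le inter_subset_right (h2 ▸ h1)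
      have h3 := key _ (last_notMem hH1) hH3
      intro y hy
      by_cases hyH : y ∈ insert (s + 1) H
      · exact h3 hyH
      · have hy' : y ∈ Icc 1 s := by
          rw [Icc_one_succ] at hy
          exact (mem_insert.1 hy).resolve_left fun h => hyH (h ▸ mem_insert_self _ _)
        have hyH' : y ∉ H := fun h => hyH (mem_insert_of_mem h)
        exact key y hyH' (shift_last ho.shifted_right hH1 hH3 hy' hyH') (mem_insert_self _ _)
    refine (weight_mono hsub).trans ?_
    rw [weight, sum_singleton, Nat.card_Icc, Nat.add_sub_cancel, lostWeight]
    exact Nat.le_mul_of_pos_left _ (card_pos.2 hG)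
  have h1 := ho.exchange (by omega)
  have h2 := spread_le (e := f) (r := q) ho.up_right ho.shifted_right hhs
  have hA : (0 : ℤ) < lostWeight s s (e + r) (s + 1 + r) 𝒢 := by
    have := Nat.mul_pos (card_pos.2 hG) (levelWeight_pos e r s)
    exact_mod_cast this
  have hB : (0 : ℤ) < lostWeight s h (f + q) (h + 1 + q) ℋ := by
    have := Nat.mul_pos (card_pos.2 hH) (levelWeight_pos f q h)
    exact_mod_cast this
  zify at hX hht
  set A : ℤ := ↑(lostWeight s s (e + r) (s + 1 + r) 𝒢)
  set B : ℤ := ↑(lostWeight s h (f + q) (h + 1 + q) ℋ)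
  set X : ℤ := ↑(weight (e + r) (s + 1 + r) 𝒢)
  set Y : ℤ := ↑(weight (f + q) (h + 1 + q) ℋ)
  have h3 : e * (Y - B) ≤ (r + 1) * B := by
    refine le_of_mul_le_mul_left ?_ hA
    have := mul_le_mul_of_nonneg_left hX (by positivity : (0 : ℤ) ≤ (r + 1) * B)
    linarith
  have h4 : (s - h) * B ≤ t * (Y - B) := by
    refine le_of_mul_le_mul_left ?_ (by positivity : (0 : ℤ) < f + 1)
    have h5 : (0 : ℤ) ≤ (s - h) * q * B :=
      mul_nonneg (mul_nonneg (by omega) (by positivity)) hB.le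
    rw [hht] at h2
    linarith
  have h6 := mul_le_mul_of_nonneg_left h3 (by positivity : (0 : ℤ) ≤ t)
  have h7 := mul_le_mul_of_nonneg_left h4 (by positivity : (0 : ℤ) ≤ e)
  have h8 := mul_lt_mul_of_pos_right hn hB
  linarith

lemma IsOptimal.eq_of_pivotal {t s n m k l g h : ℕ} {𝒢 ℋ : Finset (Finset ℕ)} (ht : 3 ≤ t)
    (htl : t ≤ l) (hlk : l ≤ k) (hn : (t + 1) * (k - t + 1) ≤ n)
    (hm : (t + 1) * (k - t + 1) ≤ m) (hts : t ≤ s) (hsn : s + 1 ≤ n) (hsm : s + 1 ≤ m)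
    (ho : IsOptimal t (s + 1) (n - (s + 1)) k (m - (s + 1)) l 𝒢 ℋ) (hgk : g + 1 ≤ k)
    (hhl : h + 1 ≤ l) (hgh : g + h + 1 = s + t) (hG : (pivotal s g 𝒢).Nonempty)
    (hH : (pivotal s h ℋ).Nonempty) : g = t ∧ h = t := by
  obtain ⟨c, hc⟩ := Nat.exists_eq_add_of_le (le_succ_of_pivotal ho.cross hG hH)
  obtain ⟨d, hd⟩ := Nat.exists_eq_add_of_le (le_succ_of_pivotal ho.cross.symm hH hG)
  obtain ⟨r, rfl⟩ := Nat.exists_eq_add_of_le hgk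
  obtain ⟨q, rfl⟩ := Nat.exists_eq_add_of_le hhl
  rw [show g + 1 + r - t + 1 = c + r + 1 by omega] at hn hm
  have htc : 3 * c ≤ t * c := Nat.mul_le_mul_right _ ht
  have htr : 3 * r ≤ t * r := Nat.mul_le_mul_right _ ht
  obtain ⟨e, he⟩ : ∃ e, n - (s + 1) = e + r := ⟨n - (s + 1) - r, by
    have : (t + 1) * (c + r + 1) = t * c + t * r + t + c + r + 1 := by ring
    omega⟩
  obtain ⟨f, hf⟩ : ∃ f, m - (s + 1) = f + q := ⟨m - (s + 1) - q, by
    have : (t + 1) * (c + r + 1) = t * c + t * r + t + c + r + 1 := by ring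
    omega⟩
  rw [he, hf] at ho
  have hn' : t * c + t * r + 1 ≤ e + d := by
    have : (t + 1) * (c + r + 1) = t * c + t * r + t + c + r + 1 := by ring
    omega
  have hm' : t * c + t * r + 1 + r ≤ f + q + d := by
    have : (t + 1) * (c + r + 1) = t * c + t * r + t + c + r + 1 := by ring
    omega
  have hKL : t * (d + q) ≤ t * (c + r) := Nat.mul_le_mul_left _ (by omega)
  rcases Nat.eq_zero_or_pos d with rfl | hd0
  · obtain rfl : g = s := by omega
    refine (ho.false_of_full hd hG hH (by omega) ?_).elim
    have h1 : (g : ℤ) - h = c := by omega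
    rw [h1]
    have h2 : (1 : ℤ) ≤ c := by omega
    have h3 : (t : ℤ) * 1 ≤ t * c := by gcongr
    have h4 : (e : ℤ) * 1 ≤ e * c := by gcongr
    zify at hn'
    linarith
  rcases Nat.eq_zero_or_pos c with rfl | hc0
  · obtain rfl : h = s := by omega
    refine (ho.symm.false_of_full hc hH hG (by omega) ?_).elim
    have h1 : (h : ℤ) - g = d := by omega
    rw [h1]
    have h2 : (1 : ℤ) ≤ d := by omega
    have h3 : d + q ≤ r := by omega
    have h4 : (t : ℤ) * 1 ≤ t * d := by gcongr
    have h5 : (f : ℤ) * 1 ≤ f * d := by gcongr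
    zify at hm' hKL h3
    linarith
  by_contra hne
  obtain ⟨u, rfl⟩ := Nat.exists_eq_add_of_le' hc0
  obtain ⟨v, rfl⟩ := Nat.exists_eq_add_of_le' hd0
  obtain ⟨τ, rfl⟩ := Nat.exists_eq_add_of_le' (by omega : 1 ≤ t)
  have hpq : q + v ≤ r + u := by omega
  have hτ : (2 : ℤ) ≤ τ := by omega
  have hτ0 : (0 : ℤ) ≤ τ := by omega
  have hτpq : (τ : ℤ) * (q + v) ≤ τ * (r + u) := by exact_mod_cast Nat.mul_le_mul_left _ hpq
  have hτu : (0 : ℤ) ≤ τ * u := by positivity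
  have hτv : (0 : ℤ) ≤ τ * v := by positivity
  zify at hn' hm' hpq
  have e1 : ((τ : ℤ) + 1) * (r + 1) + (τ + 1) * u - v ≤ e := by linarith
  have e2 : ((τ : ℤ) + 1) * (q + 1) + (τ + 1) * v - u ≤ f := by linarith
  have e3 : (τ : ℤ) * (r + 1) ≤ e := by linarith
  have e4 : (τ + 1 : ℤ) * (q + 1) ≤ e := by linarith
  have e5 : (τ : ℤ) * (q + 1) ≤ f := by linarith
  have e6 : (τ + 1 : ℤ) * (r + 1) ≤ f := by linarith
  have hD : (r + 1) * (q + 1) ≤ e * f := by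
    zify
    have : (q + 1 : ℤ) ≤ f := by nlinarith
    have : (r + 1 : ℤ) ≤ e := by nlinarith
    gcongr
  have hg1 : (g : ℤ) + 1 = τ + 2 + u := by omega
  have hh1 : (h : ℤ) + 1 = τ + 2 + v := by omega
  have hsg : (s : ℤ) - g = v + 1 := by omega
  have hsh : (s : ℤ) - h = u + 1 := by omega
  rcases le_or_gt u v with huv | huv
  · have h1 := ho.numeric hgh hG hH (by omega) hD
    have h2 := numeric_lt hτ (by omega) (by omega : (u : ℤ) ≤ v) (by omega)
      (by omega : 1 ≤ (r : ℤ) + 1)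
      (by omega) e2 e3 e4
    rw [hsg, hg1] at h1
    linarith
  · have h1 := ho.symm.numeric (by omega) hH hG (by omega) (by linarith)
    have h2 := numeric_lt hτ (by omega) (by omega : (v : ℤ) ≤ u) (by omega)
      (by omega : 1 ≤ (q : ℤ) + 1)
      (by omega) e1 e5 e6
    rw [hsh, hh1] at h1
    linarith

/-! ### Small ground sets and the induction -/

lemma IsOptimal.false_of_card_le {t e r f q : ℕ} {𝒢 ℋ : Finset (Finset ℕ)}
    (ho : IsOptimal t (t + 1 + 1) (e + r) (t + 1 + r) (f + q) (t + 1 + q) 𝒢 ℋ)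
    (hG : (pivotal (t + 1) t 𝒢).Nonempty) (hH : (pivotal (t + 1) t ℋ).Nonempty)
    (he : 3 * (r + 1) ≤ e) (hf : 3 * (q + 1) ≤ f) {H : Finset ℕ} (hHm : H ∈ ℋ) (hHc : #H ≤ t) :
    False := by
  have hsub : ∀ G ∈ 𝒢, H ⊆ G := fun G hG => by
    rw [← inter_eq_right]
    exact eq_of_subset_of_card_le inter_subset_right (hHc.trans (ho.cross G hG H hHm))
  have hN : #(pivotal (t + 1) t 𝒢) = 1 := by
    refine le_antisymm (card_le_one_iff_subset_singleton.2 ⟨H, fun G hG => ?_⟩) (card_pos.2 hG)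
    obtain ⟨⟨hG1, hG2⟩, hG3, -⟩ := mem_pivotal.1 hG
    have hHt := (ho.cross _ hG3 _ hHm).trans (card_le_card inter_subset_right)
    have hlast : t + 1 + 1 ∉ H := fun hz => by
      obtain ⟨y, hy, hyG⟩ := exists_mem_notMem_of_card_lt_card
        (show #G < #(Icc 1 (t + 1)) by rw [Nat.card_Icc]; omega)
      have := hsub _ (shift_last ho.shifted_left hG1 hG3 hy hyG) hz
      exact last_notMem (insert_subset hy hG1) this
    have := (subset_insert_iff_of_notMem hlast).1 (hsub _ hG3)
    exact mem_singleton.2 (eq_of_subset_of_card_le this (by omega)).symm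
  have hR := card_pivotal_mul_le (s := t + 1) (g := t) ho.shifted_left
  have hR' : 1 ≤ #(upperLevel (t + 1) t 𝒢) := by
    rw [hN, Nat.add_sub_cancel_left] at hR
    exact Nat.pos_of_ne_zero fun h => by simp [h] at hR
  have h1 := le_weight (g := t) (e + r) (t + 1 + r) ho.up_left
  have h2 := ho.surplus_le (by omega) hH
  have hw := levelWeight_pos e r t
  rw [hN, one_mul] at h1
  rw [lostWeight, hN, one_mul] at h2
  have h3 := Nat.mul_le_mul hR' (Nat.le_add_right (levelWeight (e + r) (t + 1 + r) (t + 1))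
    (levelWeight (e + r) (t + 1 + r) (t + 2)))
  zify at h1 h3 hw he hf
  set w : ℤ := ↑(levelWeight (e + r) (t + 1 + r) (t + 1))
  set X : ℤ := ↑(weight (e + r) (t + 1 + r) 𝒢)
  have h4 : w ≤ X - w := by linarith
  have h5 := mul_le_mul he hf (by positivity) (by positivity)
  have h6 : (0 : ℤ) ≤ e * f - (r + 1) * (q + 1) := by nlinarith
  have h7 := mul_le_mul_of_nonneg_left h4 h6
  have h8 := le_of_mul_le_mul_right (h7.trans h2) hw
  have h9 := mul_le_mul_of_nonneg_left hf (by positivity : (0 : ℤ) ≤ e)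
  have h10 := mul_le_mul_of_nonneg_right he (by positivity : (0 : ℤ) ≤ q + 1)
  nlinarith [mul_pos (by positivity : (0 : ℤ) < r + 1) (by positivity : (0 : ℤ) < q + 1)]

lemma weight_le_of_lt_card {t k n : ℕ} {𝒢 : Finset (Finset ℕ)} (hk : t + 1 ≤ k)
    (hn : (t + 1) * (k - t + 1) ≤ n) (h𝒢 : 𝒢 ⊆ (Icc 1 (t + 2)).powerset)
    (hc : ∀ G ∈ 𝒢, t < #G) : weight (n - (t + 2)) k 𝒢 ≤ (n - t).choose (k - t) := by
  obtain ⟨r, rfl⟩ := Nat.exists_eq_add_of_le hk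
  rw [show t + 1 + r - t + 1 = r + 2 by omega] at hn
  have hn' : (t + 1) * (r + 2) = t * (r + 1) + t + r + 2 := by ring
  obtain ⟨e, rfl⟩ := Nat.exists_eq_add_of_le (by omega : t + 2 + r ≤ n)
  have he : t * (r + 1) ≤ e := by omega
  have hsub : 𝒢 ⊆ (Icc 1 (t + 2)).powersetCard (t + 1) ∪ {Icc 1 (t + 2)} := fun G hG => by
    have h1 := mem_powerset.1 (h𝒢 hG)
    have h2 := card_le_card h1
    rw [Nat.card_Icc, Nat.add_sub_cancel] at h2
    have h3 := hc G hG
    rw [mem_union, mem_powersetCard, mem_singleton]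
    by_cases h4 : #G = t + 1
    · exact Or.inl ⟨h1, h4⟩
    · exact Or.inr (eq_of_subset_of_card_le h1 (by rw [Nat.card_Icc]; omega))
  have hdis : Disjoint ((Icc 1 (t + 2)).powersetCard (t + 1)) {Icc 1 (t + 2)} := by
    rw [disjoint_singleton_right, mem_powersetCard, Nat.card_Icc]
    omega
  have h1 : weight (e + r) (t + 1 + r) 𝒢 ≤
      (t + 2) * levelWeight (e + r) (t + 1 + r) (t + 1) +
        levelWeight (e + r) (t + 1 + r) (t + 2) := by
    refine (weight_mono hsub).trans_eq ?_
    rw [weight, sum_union hdis, sum_singleton,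
      sum_congr rfl fun G hG => by rw [(mem_powersetCard.1 hG).2], sum_const, card_powersetCard,
      Nat.card_Icc, Nat.add_sub_cancel, smul_eq_mul, Nat.choose_succ_self_right]
  have h2 : (t + 2 + r + e - t).choose (t + 1 + r - t) =
      levelWeight (e + r + 1 + 1) (t + 1 + r) t := by
    rw [levelWeight, if_pos (by omega)]
    congr 1
    omega
  rw [h2, ← levelWeight_add, ← levelWeight_add, ← levelWeight_add,
    show t + 2 + r + e - (t + 2) = e + r by omega]
  have h3 : t * levelWeight (e + r) (t + 1 + r) (t + 1) ≤ levelWeight (e + r) (t + 1 + r) t := by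
    refine Nat.le_of_mul_le_mul_left (c := r + 1) ?_ (by omega)
    rw [mul_levelWeight, ← mul_assoc, mul_comm (r + 1)]
    exact Nat.mul_le_mul_right _ he
  linarith

lemma weight_le_of_cross {t k n : ℕ} {𝒢 ℋ : Finset (Finset ℕ)} (hk : t ≤ k)
    (h𝒢 : 𝒢 ⊆ (Icc 1 t).powerset) (hc : Cross t 𝒢 ℋ) (hℋ : ℋ.Nonempty) :
    weight (n - t) k 𝒢 ≤ (n - t).choose (k - t) := by
  obtain ⟨H, hH⟩ := hℋ
  have hsub : 𝒢 ⊆ {Icc 1 t} := fun G hG => by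
    refine mem_singleton.2 (eq_of_subset_of_card_le (mem_powerset.1 (h𝒢 hG)) ?_)
    rw [Nat.card_Icc, Nat.add_sub_cancel]
    exact (hc G hG H hH).trans (card_le_card inter_subset_left)
  refine (weight_mono hsub).trans ?_
  rw [weight, sum_singleton, Nat.card_Icc, Nat.add_sub_cancel, levelWeight, if_pos hk]

lemma weight_mul_weight_le_of_le {t s n m k l : ℕ} {𝒢 ℋ : Finset (Finset ℕ)} (htk : t ≤ k)
    (htl : t ≤ l) (hst : s ≤ t) (h𝒢 : 𝒢 ⊆ (Icc 1 s).powerset) (hℋ : ℋ ⊆ (Icc 1 s).powerset)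
    (hc : Cross t 𝒢 ℋ) : weight (n - s) k 𝒢 * weight (m - s) l ℋ ≤
      (n - t).choose (k - t) * (m - t).choose (l - t) := by
  rcases 𝒢.eq_empty_or_nonempty with rfl | hG
  · simp [weight]
  rcases ℋ.eq_empty_or_nonempty with rfl | hH
  · simp [weight]
  obtain rfl : s = t := by
    obtain ⟨G, hG⟩ := hG
    obtain ⟨H, hH⟩ := hH
    have h1 := card_le_card (inter_subset_left.trans (mem_powerset.1 (h𝒢 hG)) : G ∩ H ⊆ Icc 1 s)
    rw [Nat.card_Icc, Nat.add_sub_cancel] at h1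
    exact le_antisymm hst ((hc G hG H hH).trans h1)
  exact Nat.mul_le_mul (weight_le_of_cross htk h𝒢 hc hH) (weight_le_of_cross htl hℋ hc.symm hG)

lemma IsOptimal.weight_mul_weight_le {t n m k l : ℕ} {𝒢 ℋ : Finset (Finset ℕ)} (ht : 3 ≤ t)
    (hlk : l ≤ k) (hn : (t + 1) * (k - t + 1) ≤ n) (hm : (t + 1) * (k - t + 1) ≤ m)
    (ho : IsOptimal t (t + 2) (n - (t + 2)) k (m - (t + 2)) l 𝒢 ℋ) (htk : t + 1 ≤ k)
    (htl : t + 1 ≤ l) (hG : (pivotal (t + 1) t 𝒢).Nonempty)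
    (hH : (pivotal (t + 1) t ℋ).Nonempty) :
    weight (n - (t + 2)) k 𝒢 * weight (m - (t + 2)) l ℋ ≤
      (n - t).choose (k - t) * (m - t).choose (l - t) := by
  have hm' : (t + 1) * (l - t + 1) ≤ m :=
    le_trans (Nat.mul_le_mul_left _ (by omega)) hm
  by_cases h1 : (∀ G ∈ 𝒢, t < #G) ∧ ∀ H ∈ ℋ, t < #H
  · exact Nat.mul_le_mul (weight_le_of_lt_card htk hn ho.sub_left h1.1)
      (weight_le_of_lt_card htl hm' ho.sub_right h1.2)
  exfalso
  obtain ⟨r, rfl⟩ := Nat.exists_eq_add_of_le htk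
  obtain ⟨q, rfl⟩ := Nat.exists_eq_add_of_le htl
  rw [show t + 1 + r - t + 1 = r + 2 by omega] at hn
  rw [show t + 1 + q - t + 1 = q + 2 by omega] at hm'
  have hr : (t + 1) * (r + 2) = t * (r + 1) + t + r + 2 := by ring
  have hq : (t + 1) * (q + 2) = t * (q + 1) + t + q + 2 := by ring
  have htr : 3 * (r + 1) ≤ t * (r + 1) := Nat.mul_le_mul_right _ ht
  have htq : 3 * (q + 1) ≤ t * (q + 1) := Nat.mul_le_mul_right _ ht
  obtain ⟨e, rfl⟩ := Nat.exists_eq_add_of_le (by omega : t + 2 + r ≤ n)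
  obtain ⟨f, rfl⟩ := Nat.exists_eq_add_of_le (by omega : t + 2 + q ≤ m)
  rw [show t + 2 + r + e - (t + 2) = e + r by omega,
    show t + 2 + q + f - (t + 2) = f + q by omega] at ho
  rw [not_and_or] at h1
  push Not at h1
  rcases h1 with ⟨G, hGm, hGc⟩ | ⟨H, hHm, hHc⟩
  · exact ho.symm.false_of_card_le hH hG (by omega) (by omega) hGm hGc
  · exact ho.false_of_card_le hG hH (by omega) (by omega) hHm hHc

theorem weight_mul_weight_le {t n m k l : ℕ} (ht : 3 ≤ t) (htl : t ≤ l) (hlk : l ≤ k)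
    (hn : (t + 1) * (k - t + 1) ≤ n) (hm : (t + 1) * (k - t + 1) ≤ m) {s : ℕ} (hsn : s ≤ n)
    (hsm : s ≤ m) {𝒢 ℋ : Finset (Finset ℕ)} (h𝒢 : 𝒢 ⊆ (Icc 1 s).powerset)
    (hℋ : ℋ ⊆ (Icc 1 s).powerset) (hc : Cross t 𝒢 ℋ) :
    weight (n - s) k 𝒢 * weight (m - s) l ℋ ≤
      (n - t).choose (k - t) * (m - t).choose (l - t) := by
  induction s generalizing 𝒢 ℋ with
  | zero => exact weight_mul_weight_le_of_le (htl.trans hlk) htl (Nat.zero_le _) h𝒢 hℋ hc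
  | succ s ih =>
    by_cases hst : s + 1 ≤ t
    · exact weight_mul_weight_le_of_le (htl.trans hlk) htl hst h𝒢 hℋ hc
    obtain ⟨𝒢', ℋ', ho⟩ := exists_isOptimal t (s + 1) (n - (s + 1)) k (m - (s + 1)) l
    refine (ho.max _ h𝒢 _ hℋ hc).trans ?_
    by_cases hp : ∀ g h, g + 1 ≤ k → h + 1 ≤ l → g + h + 1 = s + t →
        pivotal s g 𝒢' = ∅ ∨ pivotal s h ℋ' = ∅
    · have h1 := weight_le_project (a := n - (s + 1)) (k := k) ho.sub_left
      have h2 := weight_le_project (a := m - (s + 1)) (k := l) ho.sub_right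
      rw [show n - (s + 1) + 1 = n - s by omega] at h1
      rw [show m - (s + 1) + 1 = m - s by omega] at h2
      exact (Nat.mul_le_mul h1 h2).trans (ih (by omega) (by omega) (filter_subset _ _)
        (filter_subset _ _) (cross_project ho.cross ho.shifted_left ho.up_left ho.up_right hp))
    · push Not at hp
      obtain ⟨g, h, hgk, hhl, hgh, hG, hH⟩ := hp
      obtain ⟨rfl, rfl⟩ := ho.eq_of_pivotal ht htl hlk hn hm (by omega) hsn hsm hgk hhl hgh hG hH
      obtain rfl : s = h + 1 := by omega
      exact ho.weight_mul_weight_le ht hlk hn hm hgk hhl hG hH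

lemma card_le_weight_image {n k s : ℕ} {𝒜 : Finset (Finset ℕ)}
    (h𝒜 : 𝒜 ⊆ (Icc 1 n).powersetCard k) :
    #𝒜 ≤ weight (n - s) k (𝒜.image (· ∩ Icc 1 s)) := by
  rw [card_eq_sum_card_image (· ∩ Icc 1 s) 𝒜, weight]
  refine sum_le_sum fun G hG => ?_
  obtain ⟨A₀, hA₀, rfl⟩ := mem_image.1 hG
  have hcard : #(A₀ ∩ Icc 1 s) ≤ k :=
    (mem_powersetCard.1 (h𝒜 hA₀)).2 ▸ card_le_card inter_subset_left
  rw [levelWeight, if_pos hcard]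
  have : #((Icc (s + 1) n).powersetCard (k - #(A₀ ∩ Icc 1 s))) =
      (n - s).choose (k - #(A₀ ∩ Icc 1 s)) := by
    rw [card_powersetCard, Nat.card_Icc]
    congr 1
    omega
  rw [← this]
  refine card_le_card_of_injOn (· \ Icc 1 s) (fun A hA => ?_) (fun A hA B hB he => ?_)
  · obtain ⟨hA, hAs⟩ := mem_filter.1 hA
    obtain ⟨hA1, hA2⟩ := mem_powersetCard.1 (h𝒜 hA)
    refine mem_powersetCard.2 ⟨fun x hx => ?_, ?_⟩
    · obtain ⟨hx1, hx2⟩ := mem_sdiff.1 hx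
      have := mem_Icc.1 (hA1 hx1)
      rw [mem_Icc] at hx2 ⊢
      omega
    · have := card_sdiff_add_card_inter A (Icc 1 s)
      rw [hAs, hA2] at this
      exact Nat.eq_sub_of_add_eq this
  · rw [← sdiff_union_inter A (Icc 1 s), ← sdiff_union_inter B (Icc 1 s),
      (mem_filter.1 hA).2, (mem_filter.1 hB).2, show A \ Icc 1 s = B \ Icc 1 s from he]

end CrossIntersecting

/-- Let `n, m, l, k, t` be positive integers with `3 ≤ t ≤ l ≤ k` and
`min{m,n} ≥ (t+1)(k−t+1)`. If `𝒜 ⊆ C([n],k)` and `ℬ ⊆ C([m],l)` are cross-`t`-intersecting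
families, then `|𝒜|·|ℬ| ≤ C(n−t,k−t)·C(m−t,l−t)`. -/
theorem cross_t_intersecting_product_bound
    (n m l k t : ℕ) (ht : 3 ≤ t) (htl : t ≤ l) (hlk : l ≤ k)
    (hmin : (t + 1) * (k - t + 1) ≤ min m n)
    (𝒜 ℬ : Finset (Finset ℕ))
    (h𝒜 : 𝒜 ⊆ (Finset.Icc 1 n).powersetCard k)
    (hℬ : ℬ ⊆ (Finset.Icc 1 m).powersetCard l)
    (hcross : ∀ A ∈ 𝒜, ∀ B ∈ ℬ, t ≤ (A ∩ B).card) :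
    𝒜.card * ℬ.card ≤ (n - t).choose (k - t) * (m - t).choose (l - t) := by
  have hsub : ∀ 𝒞 : Finset (Finset ℕ),
      𝒞.image (· ∩ Finset.Icc 1 (min n m)) ⊆ (Finset.Icc 1 (min n m)).powerset := fun 𝒞 C hC => by
    obtain ⟨A, -, rfl⟩ := Finset.mem_image.1 hC
    exact Finset.mem_powerset.2 Finset.inter_subset_right
  have hc : CrossIntersecting.Cross t (𝒜.image (· ∩ Finset.Icc 1 (min n m)))
      (ℬ.image (· ∩ Finset.Icc 1 (min n m))) := by
    intro G hG H hH
    obtain ⟨A, hA, rfl⟩ := Finset.mem_image.1 hG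
    obtain ⟨B, hB, rfl⟩ := Finset.mem_image.1 hH
    refine (hcross A hA B hB).trans (Finset.card_le_card fun x hx => ?_)
    obtain ⟨hxA, hxB⟩ := Finset.mem_inter.1 hx
    have h1 := Finset.mem_Icc.1 ((Finset.mem_powersetCard.1 (h𝒜 hA)).1 hxA)
    have h2 := Finset.mem_Icc.1 ((Finset.mem_powersetCard.1 (hℬ hB)).1 hxB)
    have h3 : x ∈ Finset.Icc 1 (min n m) := Finset.mem_Icc.2 ⟨h1.1, le_min h1.2 h2.2⟩
    exact Finset.mem_inter.2 ⟨Finset.mem_inter.2 ⟨hxA, h3⟩, Finset.mem_inter.2 ⟨hxB, h3⟩⟩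
  obtain ⟨hm, hn⟩ := le_min_iff.1 hmin
  exact (Nat.mul_le_mul (CrossIntersecting.card_le_weight_image h𝒜)
    (CrossIntersecting.card_le_weight_image hℬ)).trans
    (CrossIntersecting.weight_mul_weight_le ht htl hlk hn hm (min_le_left _ _) (min_le_right _ _)
      (hsub 𝒜) (hsub ℬ) hc)
end

section
/- Let n, m, k, l, s, t, i be positive integers with min{m,n} ≥ (t+1)(k−t+1), k ≥ l > t ≥ 3, i+2 ≤ s ≤ i+k−t, and t+2 ≤ i ≤ k. Then, as integers, (m−l+t−i)·(n−s−k+i)·S(n,s,i,k)·S(m,s,s+t−i,l) > (m−s+1)·(n−s+1)·T(n,s,i,k)·T(m,s,s+t−i,l). -/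
/-- `S(n,s,i,j) = s(n−s+1) − i(j−i)`. -/
def Sfun (n s i j : ℤ) : ℤ := s * (n - s + 1) - i * (j - i)

/-- `T(n,s,i,j) = i(n−j−s+i+1) + (s−i)(j−i+1)`. -/
def Tfun (n s i j : ℤ) : ℤ := i * (n - j - s + i + 1) + (s - i) * (j - i + 1)

/-- `Tfun` in the variables `N = n - s + 1`, `y = j - i + 1`, `a = s - i`. -/
def shiftedT (N y i a : ℤ) : ℤ := i * (N + 1 - y) + a * y

/-- `Sfun` in the variables `N = n - s + 1`, `y = j - i + 1`, `a = s - i`. -/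
def shiftedS (N y i a : ℤ) : ℤ := (i + a) * N - i * (y - 1)

lemma shiftedS_pos {N y i a : ℤ} (hi : 0 < i) (ha : 0 ≤ a) (hN : 0 ≤ N) (hy : y ≤ N) :
    0 < shiftedS N y i a := by
  have h₁ := mul_nonneg ha hN
  have h₂ : 0 < i * (N - y + 1) := mul_pos hi (by linarith)
  unfold shiftedS
  linarith

lemma shiftedT_nonneg {N y i a : ℤ} (hi : 0 ≤ i) (ha : 0 ≤ a) (hy0 : 0 ≤ y) (hy : y ≤ N) :
    0 ≤ shiftedT N y i a := by
  have : 0 ≤ N + 1 - y := by linarith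
  unfold shiftedT
  positivity

/-- The ratio `T / ((N - y) S)` increases with `y`. -/
lemma shifted_mono_right {N y y₀ i a : ℤ} (hi : 0 < i) (ha : 0 ≤ a) (hy : y ≤ y₀)
    (hy₀ : 0 ≤ y₀) (hyN : y₀ ≤ N) :
    shiftedT N y i a * ((N - y₀) * shiftedS N y₀ i a) ≤
      shiftedT N y₀ i a * ((N - y) * shiftedS N y i a) := by
  have hN : 0 ≤ N := by linarith
  have hT : shiftedT N y i a * (N - y₀) ≤ shiftedT N y₀ i a * (N - y) := by
    have : 0 ≤ (y₀ - y) * (i + a * N) := mul_nonneg (by linarith) (by positivity)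
    unfold shiftedT
    linarith
  have hS : shiftedS N y₀ i a ≤ shiftedS N y i a := by
    have := mul_nonneg hi.le (sub_nonneg.2 hy)
    unfold shiftedS
    linarith
  have := mul_le_mul hT hS (shiftedS_pos hi ha hN hyN).le
    (mul_nonneg (shiftedT_nonneg hi.le ha hy₀ hyN) (by linarith))
  linarith

/-- The ratio `N T / ((N - y) S)` decreases with `N`. -/
lemma shifted_anti_left {N N₀ y i a : ℤ} (hi : 0 < i) (ha : 0 ≤ a) (hy : 0 ≤ y)
    (hyN : y ≤ N₀) (hN : N₀ ≤ N) :
    N * shiftedT N y i a * ((N₀ - y) * shiftedS N₀ y i a) ≤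
      N₀ * shiftedT N₀ y i a * ((N - y) * shiftedS N y i a) := by
  have h₁ : N * (N₀ - y) ≤ N₀ * (N - y) := by linarith [mul_nonneg hy (sub_nonneg.2 hN)]
  have h₂ : shiftedT N y i a * shiftedS N₀ y i a ≤ shiftedT N₀ y i a * shiftedS N y i a := by
    have : 0 ≤ (N - N₀) * (a * (i + a * y)) := mul_nonneg (by linarith) (by positivity)
    unfold shiftedT shiftedS
    linarith
  have := mul_le_mul h₁ h₂
    (mul_nonneg (shiftedT_nonneg hi.le ha hy (hyN.trans hN))
      (shiftedS_pos hi ha (hy.trans hyN) hyN).le)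
    (mul_nonneg (hy.trans hyN) (by linarith))
  linarith

/-- The ratio `N T / ((N - y) S)` is largest for the smallest `N` and the largest `y`. -/
lemma shifted_le_extremal {N N₀ y y₀ i a : ℤ} (hi : 0 < i) (ha : 0 ≤ a) (hy : y ≤ y₀)
    (hy₀ : 0 ≤ y₀) (hyN : y₀ < N₀) (hN : N₀ ≤ N) :
    N * shiftedT N y i a * ((N₀ - y₀) * shiftedS N₀ y₀ i a) ≤
      N₀ * shiftedT N₀ y₀ i a * ((N - y) * shiftedS N y i a) := by
  have hSN : 0 < shiftedS N y₀ i a := shiftedS_pos hi ha (by linarith) (by linarith)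
  have hSN₀ : 0 < shiftedS N₀ y₀ i a := shiftedS_pos hi ha (by linarith) hyN.le
  have hS : 0 < shiftedS N y i a := shiftedS_pos hi ha (by linarith) (by linarith)
  have h₁ := mul_le_mul_of_nonneg_right
    (shifted_mono_right hi ha hy hy₀ (hyN.le.trans hN))
    (show 0 ≤ N * ((N₀ - y₀) * shiftedS N₀ y₀ i a) from
      mul_nonneg (by linarith) (mul_nonneg (by linarith) hSN₀.le))
  have h₂ := mul_le_mul_of_nonneg_right
    (shifted_anti_left hi ha hy₀ hyN.le hN)
    (show 0 ≤ (N - y) * shiftedS N y i a from mul_nonneg (by linarith) hS.le)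
  refine le_of_mul_le_mul_right ?_
    (show 0 < (N - y₀) * shiftedS N y₀ i a from mul_pos (by linarith) hSN)
  linarith

set_option maxRecDepth 10000 in
/-- The inequality at the extremal values, where `a = s - i`, `b = i - t`, `p = k - t`,
for `a ≤ b`. -/
lemma extremal_of_le {a b p t : ℤ} (ht : 3 ≤ t) (ha : 2 ≤ a) (hab : a ≤ b) (hbp : b ≤ p) :
    ((t + 1) * p + 2 - a - b) * shiftedT ((t + 1) * p + 2 - a - b) (p - b + 1) (t + b) a *
        (((t + 1) * p + 2 - a - b) * shiftedT ((t + 1) * p + 2 - a - b) (p - a + 1) (t + a) b) <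
      ((t + 1) * p + 2 - a - b - (p - b + 1)) *
          shiftedS ((t + 1) * p + 2 - a - b) (p - b + 1) (t + b) a *
        (((t + 1) * p + 2 - a - b - (p - a + 1)) *
          shiftedS ((t + 1) * p + 2 - a - b) (p - a + 1) (t + a) b) := by
  obtain ⟨T, rfl⟩ := Int.le.dest ht
  obtain ⟨A, rfl⟩ := Int.le.dest ha
  obtain ⟨B, rfl⟩ := Int.le.dest hab
  obtain ⟨G, rfl⟩ := Int.le.dest hbp
  rw [← sub_pos]
  unfold shiftedT shiftedS
  ring_nf
  positivity

lemma extremal {a b p t : ℤ} (ht : 3 ≤ t) (ha : 2 ≤ a) (hb : 2 ≤ b) (hap : a ≤ p) (hbp : b ≤ p) :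
    ((t + 1) * p + 2 - a - b) * shiftedT ((t + 1) * p + 2 - a - b) (p - b + 1) (t + b) a *
        (((t + 1) * p + 2 - a - b) * shiftedT ((t + 1) * p + 2 - a - b) (p - a + 1) (t + a) b) <
      ((t + 1) * p + 2 - a - b - (p - b + 1)) *
          shiftedS ((t + 1) * p + 2 - a - b) (p - b + 1) (t + b) a *
        (((t + 1) * p + 2 - a - b - (p - a + 1)) *
          shiftedS ((t + 1) * p + 2 - a - b) (p - a + 1) (t + a) b) := by
  rcases le_total a b with hab | hab
  · exact extremal_of_le ht ha hab hbp
  · have h := extremal_of_le ht hb hab hap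
    rw [sub_right_comm _ b a] at h
    linarith

lemma shifted_lt {a b p t N M y z : ℤ} (ht : 3 ≤ t) (ha : 2 ≤ a) (hb : 2 ≤ b)
    (hap : a ≤ p) (hbp : b ≤ p) (hN : (t + 1) * p + 2 - a - b ≤ N)
    (hM : (t + 1) * p + 2 - a - b ≤ M) (hy : 0 ≤ y) (hyp : y ≤ p - b + 1)
    (hzp : z ≤ p - a + 1) :
    N * shiftedT N y (t + b) a * (M * shiftedT M z (t + a) b) <
      (N - y) * shiftedS N y (t + b) a * ((M - z) * shiftedS M z (t + a) b) := by
  have hext := extremal ht ha hb hap hbp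
  have hp : 2 * p ≤ (t + 1) * p + 2 - a - b := by
    linarith [mul_nonneg (sub_nonneg.2 ht) (show 0 ≤ p by linarith)]
  generalize (t + 1) * p + 2 - a - b = N₀ at *
  have h₁ := shifted_le_extremal (i := t + b) (a := a) (N₀ := N₀) (by linarith) (by linarith)
    hyp (by linarith) (by linarith) hN
  have h₂ := shifted_le_extremal (i := t + a) (a := b) (N₀ := N₀) (by linarith) (by linarith)
    hzp (by linarith) (by linarith) hM
  have hden {K x i c : ℤ} (hi : 0 < i) (hc : 0 ≤ c) (hK : 0 ≤ K) (hx : x < K) :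
      0 < (K - x) * shiftedS K x i c :=
    mul_pos (sub_pos.2 hx) (shiftedS_pos hi hc hK hx.le)
  have hP := @hden N y (t + b) a (by linarith) (by linarith) (by linarith) (by linarith)
  have hP' := @hden M z (t + a) b (by linarith) (by linarith) (by linarith) (by linarith)
  have hP₀ := @hden N₀ (p - b + 1) (t + b) a (by linarith) (by linarith) (by linarith)
    (by linarith)
  have hP₀' := @hden N₀ (p - a + 1) (t + a) b (by linarith) (by linarith) (by linarith)
    (by linarith)
  have hQ : 0 ≤ N * shiftedT N y (t + b) a :=
    mul_nonneg (by linarith) (shiftedT_nonneg (by linarith) (by linarith) hy (by linarith))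
  have hQ₀' : 0 ≤ N₀ * shiftedT N₀ (p - a + 1) (t + a) b :=
    mul_nonneg (by linarith)
      (shiftedT_nonneg (by linarith) (by linarith) (by linarith) (by linarith))
  have h₃ := mul_le_mul h₂ h₁ (mul_nonneg hQ hP₀.le) (mul_nonneg hQ₀' hP'.le)
  have h₄ := mul_lt_mul_of_pos_right hext (mul_pos hP hP')
  refine lt_of_mul_lt_mul_right ?_ (mul_pos hP₀ hP₀').le
  linarith

/-- For positive integers `n, m, k, l, s, t, i` with
`min{m,n} ≥ (t+1)(k−t+1)`, `k ≥ l > t ≥ 3`, `i+2 ≤ s ≤ i+k−t` and `t+2 ≤ i ≤ k`,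
`(m−l+t−i)(n−s−k+i)·S(n,s,i,k)·S(m,s,s+t−i,l) > (m−s+1)(n−s+1)·T(n,s,i,k)·T(m,s,s+t−i,l)`. -/
theorem statement2 (n m k l s t i : ℤ)
    (hn : 0 < n) (hm : 0 < m) (hk : 0 < k) (hl : 0 < l) (hs : 0 < s) (hi : 0 < i)
    (hmin : (t + 1) * (k - t + 1) ≤ min m n)
    (hkl : l ≤ k) (hlt : t < l) (ht : 3 ≤ t)
    (hsi : i + 2 ≤ s) (hsk : s ≤ i + k - t)
    (hit : t + 2 ≤ i) (hik : i ≤ k) :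
    (m - s + 1) * (n - s + 1) * Tfun n s i k * Tfun m s (s + t - i) l <
      (m - l + t - i) * (n - s - k + i) * Sfun n s i k * Sfun m s (s + t - i) l := by
  have hn' := hmin.trans (min_le_right m n)
  have hm' := hmin.trans (min_le_left m n)
  have h := shifted_lt (a := s - i) (b := i - t) (p := k - t) (N := n - s + 1) (M := m - s + 1)
    (y := k - i + 1) (z := l - (s + t - i) + 1) ht (by linarith) (by linarith) (by linarith)
    (by linarith) (by linarith) (by linarith) (by linarith) (by linarith) (by linarith)
  unfold shiftedT shiftedS at h
  unfold Tfun Sfun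
  linarith
end

section
/- Let n, m, k, l, s, t be positive integers with min{m,n} ≥ (t+1)(k−t+1), k ≥ l ≥ t+1 ≥ 4, and t+3 ≤ s ≤ k+1. Then, as integers, (t+1)(k−s+2)(m−l+t−s+2) − (s−1−t)·((m−l+t−s+1)(n−k−1) − (k−s+2)(l−t)) < 0. -/
/-- For positive integers `n, m, k, l, s, t` with
`min{m,n} ≥ (t+1)(k−t+1)`, `k ≥ l ≥ t+1 ≥ 4` and `t+3 ≤ s ≤ k+1`,
`(t+1)(k−s+2)(m−l+t−s+2) − (s−1−t)((m−l+t−s+1)(n−k−1) − (k−s+2)(l−t)) < 0`. -/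
theorem statement3 (n m k l s t : ℤ)
    (hn : 0 < n) (hm : 0 < m) (hk : 0 < k) (hl : 0 < l) (hs : 0 < s) (ht0 : 0 < t)
    (hmin : (t + 1) * (k - t + 1) ≤ min m n)
    (hkl : l ≤ k) (hlt : t + 1 ≤ l) (ht : 4 ≤ t + 1)
    (hs1 : t + 3 ≤ s) (hs2 : s ≤ k + 1) :
    (t + 1) * (k - s + 2) * (m - l + t - s + 2)
      - (s - 1 - t) * ((m - l + t - s + 1) * (n - k - 1) - (k - s + 2) * (l - t)) < 0 := by
  obtain ⟨hmin_m, hmin_n⟩ := le_min_iff.mp hmin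
  obtain ⟨K, rfl⟩ : ∃ K, k = K + t := ⟨k - t, by ring⟩
  obtain ⟨a, rfl⟩ : ∃ a, s = a + 1 + t := ⟨s - 1 - t, by ring⟩
  obtain ⟨M, rfl⟩ : ∃ M, m = M + l + a := ⟨m - l - a, by ring⟩
  obtain ⟨N, rfl⟩ : ∃ N, n = N + K + t + 1 := ⟨n - K - t - 1, by ring⟩
  obtain ⟨L, rfl⟩ : ∃ L, l = L + t := ⟨l - t, by ring⟩
  have ha : 2 ≤ a := by linarith
  have haK : a ≤ K := by linarith
  have hLK : L ≤ K := by linarith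
  have hT : 3 ≤ t := by linarith
  have hN : t * K ≤ N := by nlinarith
  have hM : K + 1 ≤ M := by nlinarith
  have hMN : a * M * (t * K) ≤ a * M * N :=
    mul_le_mul_of_nonneg_left hN (by nlinarith)
  have hcL : a * ((K - a + 1) * L) < a * (K * M) := by
    have h₁ : (K - a + 1) * L ≤ (K - a + 1) * K :=
      mul_le_mul_of_nonneg_left hLK (by linarith)
    have h₂ : (K - a + 1) * K < M * K :=
      mul_lt_mul_of_pos_right (by linarith) (by linarith)
    exact mul_lt_mul_of_pos_left (by linarith) (by linarith)
  have hcM : (K - a + 1) * (M + 1) ≤ K * M := by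
    have h₁ : (K - a + 1) * (M + 1) ≤ (K - 1) * (M + 1) :=
      mul_le_mul_of_nonneg_right (by linarith) (by linarith)
    linarith
  have hcT : (t + 1) * ((K - a + 1) * (M + 1)) ≤ (t + 1) * (K * M) :=
    mul_le_mul_of_nonneg_left hcM (by linarith)
  have hKM : (t + 1) * (K * M) ≤ a * (t - 1) * (K * M) :=
    mul_le_mul_of_nonneg_right (by nlinarith) (by nlinarith)
  linarith
end

section
/- Let n, m, k, l, s, t be positive integers with min{m,n} ≥ (t+1)(k−t+1) and k ≥ l ≥ s−1 ≥ t+2 ≥ 5. Then, as integers, (t+1)(n−s−k+t+2)(l−s+2) − (s−1−t)·((m−l−1)(n−s−k+t+1) − (k−t)(l−s+2)) < 0. -/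
/-- For positive integers `n, m, k, l, s, t` with
`min{m,n} ≥ (t+1)(k−t+1)` and `k ≥ l ≥ s−1 ≥ t+2 ≥ 5`,
`(t+1)(n−s−k+t+2)(l−s+2) − (s−1−t)((m−l−1)(n−s−k+t+1) − (k−t)(l−s+2)) < 0`. -/
theorem statement4 (n m k l s t : ℤ)
    (hn : 0 < n) (hm : 0 < m) (hk : 0 < k) (hl : 0 < l) (hs : 0 < s) (ht0 : 0 < t)
    (hmin : (t + 1) * (k - t + 1) ≤ min m n)
    (hkl : l ≤ k) (hls : s - 1 ≤ l) (hst : t + 2 ≤ s - 1) (ht : 5 ≤ t + 2) :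
    (t + 1) * (n - s - k + t + 2) * (l - s + 2)
      - (s - 1 - t) * ((m - l - 1) * (n - s - k + t + 1) - (k - t) * (l - s + 2)) < 0 := by
  obtain ⟨hm', hn'⟩ := le_min_iff.mp hmin
  obtain ⟨p, rfl⟩ : ∃ p, s = p + t + 1 := ⟨s - t - 1, by ring⟩
  obtain ⟨a, rfl⟩ : ∃ a, k = a + t := ⟨k - t, by ring⟩
  obtain ⟨b, rfl⟩ : ∃ b, l = b + t + p - 1 := ⟨l - t - p + 1, by ring⟩
  obtain ⟨N, rfl⟩ : ∃ N, n = N + p + a + t := ⟨n - p - a - t, by ring⟩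
  obtain ⟨M, rfl⟩ : ∃ M, m = M + b + t + p := ⟨m - b - t - p, by ring⟩
  have hp : 2 ≤ p := by linarith
  have ht3 : 3 ≤ t := by linarith
  have hb : 1 ≤ b := by linarith
  have hba : b ≤ a - 1 := by linarith
  have hpa : p ≤ a := by linarith
  have hM : t * a ≤ M := by nlinarith
  have hN : (t - 1) * a + 1 ≤ N := by nlinarith
  have hta : 2 * a ≤ (t - 1) * a := by nlinarith
  have hbN : b < N := by linarith
  have hMN : t * a * N ≤ M * N := mul_le_mul_of_nonneg_right hM (by linarith)
  have hab : a * b ≤ t * a * N := by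
    have h₁ : a * b ≤ a * N := mul_le_mul_of_nonneg_left hbN.le (by linarith)
    have h₂ : 0 ≤ (t - 1) * (a * N) :=
      mul_nonneg (by linarith) (mul_nonneg (by linarith) (by linarith))
    linarith
  have hp_mul : 2 * (t * a * N - a * b) ≤ p * (M * N - a * b) := by
    have h₁ : 2 * (t * a * N - a * b) ≤ p * (t * a * N - a * b) :=
      mul_le_mul_of_nonneg_right hp (by linarith)
    have h₂ : p * (t * a * N - a * b) ≤ p * (M * N - a * b) :=
      mul_le_mul_of_nonneg_left (by linarith) (by linarith)
    linarith
  have hNb : (t + 1) * N * b ≤ (t + 1) * N * (a - 1) :=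
    mul_le_mul_of_nonneg_left hba (mul_nonneg (by linarith) (by linarith))
  have hlt : b * (2 * a + t + 1) < N * ((t - 1) * a + t + 1) := by
    have h₁ : b * (2 * a + t + 1) < N * (2 * a + t + 1) :=
      mul_lt_mul_of_pos_right hbN (by linarith)
    have h₂ : N * (2 * a + t + 1) ≤ N * ((t - 1) * a + t + 1) :=
      mul_le_mul_of_nonneg_left (by linarith) (by linarith)
    linarith
  have key : (t + 1) * (N + 1) * b - p * (M * N - a * b) < 0 := by linarith
  convert key using 1
  ring
end

section
/- Let m, n, k, l, t, r be positive integers with k ≥ l ≥ t+r and min{m,n} ≥ k+l−t+2. Let T be a (t+2r)-element subset of [min{m,n}] and fix j ∈ [min{m,n}] \ T. Then for any A ∈ C([n] \ (T ∪ {j}), k−r−t) and B ∈ C([m] \ (T ∪ {j}), l−r−t) with |A ∩ B| = w, there exist A₁, A₂, …, A_{w+1} ∈ C([n] \ (T ∪ {j}), k−r−t) and B₁, B₂, …, B_{w+1} ∈ C([m] \ (T ∪ {j}), l−r−t) such that (1) A_i ∩ B_i = ∅ for i = 1,…,w+1; (2) A_{i+1} ∩ B_i = ∅ for i = 1,…,w;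 and (3) A₁ = A and B_{w+1} = B. -/
/-- Two sets `A ⊆ X`, `B ⊆ Y` of sizes `p`, `q` meeting in `w` points are joined by an alternating
chain of `w + 1` pairs of disjoint sets, provided `X ∩ Y` has at least `p + q + 1` points. -/
theorem exists_alternating_disjoint_chain {α : Type*} [DecidableEq α] (X Y : Finset α) (p q : ℕ)
    (hXY : p + q + 1 ≤ (X ∩ Y).card) (B : Finset α) (hB : B ∈ Y.powersetCard q) (w : ℕ) :
    ∀ A ∈ X.powersetCard p, (A ∩ B).card = w →
      ∃ a b : ℕ → Finset α,
        (∀ i ≤ w, a i ∈ X.powersetCard p) ∧ (∀ i ≤ w, b i ∈ Y.powersetCard q) ∧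
        (∀ i ≤ w, a i ∩ b i = ∅) ∧ (∀ i < w, a (i + 1) ∩ b i = ∅) ∧ a 0 = A ∧ b w = B := by
  induction w with
  | zero =>
    intro A hA hw
    exact ⟨fun _ => A, fun _ => B, fun _ _ => hA, fun _ _ => hB,
      fun _ _ => Finset.card_eq_zero.mp hw, fun i hi => absurd hi (Nat.not_lt_zero i), rfl, rfl⟩
  | succ w ih =>
    intro A hA hw
    obtain ⟨hAX, hAp⟩ := Finset.mem_powersetCard.mp hA
    obtain ⟨hBY, hBq⟩ := Finset.mem_powersetCard.mp hB
    obtain ⟨x, hx⟩ : (A ∩ B).Nonempty := Finset.card_pos.mp (by omega)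
    obtain ⟨hxA, hxB⟩ := Finset.mem_inter.mp hx
    obtain ⟨y, hyD, hyAB⟩ : ∃ y ∈ X ∩ Y, y ∉ A ∪ B :=
      Finset.exists_mem_notMem_of_card_lt_card (by have := Finset.card_union_le A B; omega)
    obtain ⟨hyA, hyB⟩ : y ∉ A ∧ y ∉ B := by simpa using hyAB
    obtain ⟨C, hC, hCq⟩ : ∃ C ⊆ (X ∩ Y) \ insert y A, C.card = q := by
      apply Finset.exists_subset_card_eq
      have h₁ := Finset.le_card_sdiff (insert y A) (X ∩ Y)
      have h₂ := Finset.card_insert_le y A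
      omega
    have hCmem : ∀ z ∈ C, z ∈ Y ∧ z ≠ y ∧ z ∉ A := by
      intro z hz
      have := hC hz
      simp only [Finset.mem_sdiff, Finset.mem_inter, Finset.mem_insert, not_or] at this
      exact ⟨this.1.2, this.2⟩
    have hA' : insert y (A.erase x) ∈ X.powersetCard p := by
      refine Finset.mem_powersetCard.mpr ⟨?_, ?_⟩
      · exact Finset.insert_subset (Finset.mem_inter.mp hyD).1
          ((Finset.erase_subset _ _).trans hAX)
      · rw [Finset.card_insert_of_notMem (fun h => hyA (Finset.mem_of_mem_erase h)),
          Finset.card_erase_add_one hxA, hAp]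
    have hw' : (insert y (A.erase x) ∩ B).card = w := by
      rw [Finset.insert_inter_of_notMem hyB, Finset.erase_inter, Finset.card_erase_of_mem hx, hw,
        Nat.add_sub_cancel]
    obtain ⟨a, b, ha, hb, hab, hab', ha0, hbw⟩ := ih _ hA' hw'
    refine ⟨fun i => Nat.casesOn i A a, fun i => Nat.casesOn i C b, ?_, ?_, ?_, ?_, rfl, hbw⟩
    · rintro (_ | i) hi
      exacts [hA, ha i (by omega)]
    · rintro (_ | i) hi
      exacts [Finset.mem_powersetCard.mpr ⟨fun z hz => (hCmem z hz).1, hCq⟩, hb i (by omega)]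
    · rintro (_ | i) hi
      exacts [Finset.disjoint_iff_inter_eq_empty.mp
        (Finset.disjoint_right.mpr fun z hz => (hCmem z hz).2.2), hab i (by omega)]
    · rintro (_ | i) hi
      · change a 0 ∩ C = ∅
        rw [ha0, ← Finset.disjoint_iff_inter_eq_empty, Finset.disjoint_right]
        intro z hz hz'
        rcases Finset.mem_insert.mp hz' with h | h
        exacts [(hCmem z hz).2.1 h, (hCmem z hz).2.2 (Finset.mem_of_mem_erase h)]
      · exact hab' i (by omega)

/-- Let `m, n, k, l, t, r` be positive integers with `k ≥ l ≥ t+r` and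
`min{m,n} ≥ k+l−t+2`. Let `T` be a `(t+2r)`-element subset of `[min{m,n}]` and fix
`j ∈ [min{m,n}] \ T`. For any `A ∈ C([n] \ (T ∪ {j}), k−r−t)` and
`B ∈ C([m] \ (T ∪ {j}), l−r−t)` with `|A ∩ B| = w`, there exist
`A₁, …, A_{w+1} ∈ C([n] \ (T ∪ {j}), k−r−t)` and `B₁, …, B_{w+1} ∈ C([m] \ (T ∪ {j}), l−r−t)`
(indexed here by `0, …, w`) such that `Aᵢ ∩ Bᵢ = ∅` for all `i`, `A_{i+1} ∩ B_i = ∅` for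
`i < w`, `A₁ = A` and `B_{w+1} = B`. -/
theorem statement5 (m n k l t r : ℕ)
    (hm : 1 ≤ m) (hn : 1 ≤ n) (ht : 1 ≤ t) (hr : 1 ≤ r)
    (hkl : l ≤ k) (htr : t + r ≤ l) (hmin : k + l - t + 2 ≤ min m n)
    (T : Finset ℕ) (hT : T ⊆ Finset.Icc 1 (min m n)) (hTcard : T.card = t + 2 * r)
    (j : ℕ) (hj : j ∈ Finset.Icc 1 (min m n) \ T)
    (A B : Finset ℕ) (w : ℕ)
    (hA : A ∈ (Finset.Icc 1 n \ insert j T).powersetCard (k - r - t))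
    (hB : B ∈ (Finset.Icc 1 m \ insert j T).powersetCard (l - r - t))
    (hw : (A ∩ B).card = w) :
    ∃ a b : ℕ → Finset ℕ,
      (∀ i ≤ w, a i ∈ (Finset.Icc 1 n \ insert j T).powersetCard (k - r - t)) ∧
      (∀ i ≤ w, b i ∈ (Finset.Icc 1 m \ insert j T).powersetCard (l - r - t)) ∧
      (∀ i ≤ w, a i ∩ b i = ∅) ∧
      (∀ i < w, a (i + 1) ∩ b i = ∅) ∧
      a 0 = A ∧ b w = B := by
  refine exists_alternating_disjoint_chain _ _ _ _ ?_ B hB w A hA hw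
  have hsub : Finset.Icc 1 (min m n) \ insert j T ⊆
      (Finset.Icc 1 n \ insert j T) ∩ (Finset.Icc 1 m \ insert j T) := by
    intro z hz
    simp only [Finset.mem_inter, Finset.mem_sdiff, Finset.mem_Icc] at hz ⊢
    exact ⟨⟨by omega, hz.2⟩, ⟨by omega, hz.2⟩⟩
  have h₁ := Finset.card_le_card hsub
  have h₂ := Finset.le_card_sdiff (insert j T) (Finset.Icc 1 (min m n))
  have h₃ := Finset.card_insert_le j T
  rw [Nat.card_Icc] at h₂
  omega
end

section
/- Let n, t', r be positive integers and let T be a (t'+2r)-element subset of [n]. For any distinct subsets A, B ∈ C(T, r+t'), setting w = ⌊|A ∩ B| / t'⌋ + 1, there exist subsets A₁, A₂, …, A_{2w} ∈ C(T, r+t') such that |A_i ∩ A_{i+1}| = t' for i = 1,…,2w−1, and A₁ = B, A_{2w} = A. -/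
open Finset in
/-- If at most `t` elements of `B` are exchanged, the old and the new set have a common neighbour
in the graph joining `(r + t)`-subsets of `T` that meet in exactly `t` elements. -/
theorem exists_common_neighbour {t r : ℕ} {T B U V : Finset ℕ} (hT : T.card = t + 2 * r)
    (hB : B ∈ T.powersetCard (r + t)) (hU : U ⊆ B) (hV : V ⊆ T \ B)
    (hUV : U.card = V.card) (hUt : U.card ≤ t) :
    ∃ N ∈ T.powersetCard (r + t), (B ∩ N).card = t ∧ (N ∩ (B \ U ∪ V)).card = t := by
  obtain ⟨hBT, hBc⟩ := mem_powersetCard.1 hB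
  obtain ⟨S, hUS, hSB, hS⟩ := exists_subsuperset_card_eq hU hUt (by omega)
  have hc : (T \ B).card = r := by rw [card_sdiff_of_subset hBT]; omega
  refine ⟨T \ B ∪ S, mem_powersetCard.2 ⟨by grind, ?_⟩, ?_, ?_⟩
  · rw [card_union_of_disjoint (by rw [disjoint_left]; grind)]; omega
  · rw [show B ∩ (T \ B ∪ S) = S by grind, hS]
  · rw [show (T \ B ∪ S) ∩ (B \ U ∪ V) = S \ U ∪ V by grind,
      card_union_of_disjoint (by rw [disjoint_left]; grind), card_sdiff_of_subset hUS]
    omega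

open Finset in
/-- Two `(r + t)`-subsets of `T` with at most `(m + 1) * t` common elements are joined by a walk
of length `2 * m + 1` whose consecutive members meet in exactly `t` elements. -/
theorem exists_walk_of_card_inter_le {t r : ℕ} {T A : Finset ℕ} (hT : T.card = t + 2 * r)
    (hA : A ∈ T.powersetCard (r + t)) (m : ℕ) :
    ∀ B ∈ T.powersetCard (r + t), (A ∩ B).card ≤ (m + 1) * t →
      ∃ a : ℕ → Finset ℕ, (∀ i < 2 * (m + 1), a i ∈ T.powersetCard (r + t)) ∧
        (∀ i, i + 1 < 2 * (m + 1) → (a i ∩ a (i + 1)).card = t) ∧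
        a 0 = B ∧ a (2 * m + 1) = A := by
  obtain ⟨hAT, hAc⟩ := mem_powersetCard.1 hA
  induction m with
  | zero =>
    intro B hB h
    obtain ⟨hBT, hBc⟩ := mem_powersetCard.1 hB
    have hun := card_union_add_card_inter A B
    have hle := card_le_card (union_subset hAT hBT)
    refine ⟨fun i => if i = 0 then B else A, fun i _ => ?_, fun i hi => ?_, rfl, rfl⟩
    · dsimp only
      split_ifs <;> assumption
    · obtain rfl : i = 0 := by omega
      simp only [if_true, zero_add, one_ne_zero, if_false, inter_comm B A]
      omega
  | succ m ih =>
    intro B hB h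
    obtain ⟨hBT, hBc⟩ := mem_powersetCard.1 hB
    have hun := card_union_add_card_inter A B
    have hout := card_sdiff_of_subset (union_subset hAT hBT)
    have hle := card_le_card (union_subset hAT hBT)
    obtain ⟨U, hU, hUc⟩ := exists_subset_card_eq
      (show min t ((A ∩ B).card - t) ≤ (A ∩ B).card by omega)
    obtain ⟨V, hV, hVc⟩ := exists_subset_card_eq
      (show min t ((A ∩ B).card - t) ≤ (T \ (A ∪ B)).card by omega)
    have hUB : U ⊆ B := hU.trans inter_subset_right
    obtain ⟨N, hN, hBN, hND⟩ := exists_common_neighbour hT hB hUB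
      (show V ⊆ T \ B by grind) (by omega) (by omega)
    have hD : B \ U ∪ V ∈ T.powersetCard (r + t) := by
      have := card_le_card hUB
      refine mem_powersetCard.2 ⟨by grind, ?_⟩
      rw [card_union_of_disjoint (by rw [disjoint_left]; grind), card_sdiff_of_subset hUB]
      omega
    obtain ⟨a, ha, hadj, ha0, hal⟩ := ih _ hD (by
      rw [show A ∩ (B \ U ∪ V) = (A ∩ B) \ U by grind, card_sdiff_of_subset hU, hUc]
      have h₁ : (m + 1 + 1) * t = (m + 1) * t + t := by ring
      have h₂ : (m + 1) * t = m * t + t := by ring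
      omega)
    refine ⟨fun | 0 => B | 1 => N | i + 2 => a i, ?_, ?_, rfl, hal⟩
    · rintro (_ | _ | i) hi
      · exact hB
      · exact hN
      · exact ha i (by omega)
    · rintro (_ | _ | i) hi
      · exact hBN
      · simpa only [ha0] using hND
      · exact hadj i (by omega)


/-- Let `n, t', r` be positive integers and `T` a `(t'+2r)`-element subset of
`[n]`. For any distinct `A, B ∈ C(T, r+t')`, setting `w = ⌊|A ∩ B| / t'⌋ + 1`, there exist
`A₁, …, A_{2w} ∈ C(T, r+t')` (indexed here by `0, …, 2w−1`) such that
`|Aᵢ ∩ A_{i+1}| = t'` for `i = 1, …, 2w−1`, `A₁ = B` and `A_{2w} = A`. -/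
theorem statement6 (n t' r : ℕ) (hn : 1 ≤ n) (ht' : 1 ≤ t') (hr : 1 ≤ r)
    (T : Finset ℕ) (hT : T ⊆ Finset.Icc 1 n) (hTcard : T.card = t' + 2 * r)
    (A B : Finset ℕ)
    (hA : A ∈ T.powersetCard (r + t')) (hB : B ∈ T.powersetCard (r + t'))
    (hAB : A ≠ B) :
    ∃ a : ℕ → Finset ℕ,
      (∀ i < 2 * ((A ∩ B).card / t' + 1), a i ∈ T.powersetCard (r + t')) ∧
      (∀ i, i + 1 < 2 * ((A ∩ B).card / t' + 1) → (a i ∩ a (i + 1)).card = t') ∧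
      a 0 = B ∧ a (2 * ((A ∩ B).card / t' + 1) - 1) = A := by
  exact exists_walk_of_card_inter_le hTcard hA _ B hB (by
    rw [mul_comm]
    exact (Nat.lt_mul_div_succ _ ht').le)
end
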